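/- Let α ∉ {−1,−2,−3,…} be a real number and 𝓕 = (F_1,F_2) a pair of finite sets of positive integers, not both empty. If α+1 and 𝓕 are admissible, then α + k > −1 and Ω_𝓕^α(x) ≠ 0 for every real x ≥ 0. -/

import Mathlib

open Finset MeasureTheory Polynomial

/-- Generalized binomial coefficient `C(t, j) = t(t-1)⋯(t-j+1)/j!`. -/
noncomputable def gbinom (t : ℝ) (j : ℕ) : ℝ :=
  (∏ i ∈ Finset.range j, (t - i)) / (Nat.factorial j)

/-- Pochhammer symbol `(t)_m = t(t+1)⋯(t+m-1)`. -/
noncomputable def poch (t : ℝ) (m : ℕ) : ℝ := ∏ i ∈ Finset.range m, (t + i)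

/-- Pochhammer symbol with integer index (Γ-quotient convention for negative index). -/
noncomputable def pochZ (t : ℝ) (m : ℤ) : ℝ :=
  if 0 ≤ m then ∏ i ∈ Finset.range m.toNat, (t + i)
  else (∏ i ∈ Finset.range (-m).toNat, (t - (i + 1)))⁻¹

/-- `ĉ = max(-⌊c⌋, 0)`. -/
noncomputable def chat (c : ℝ) : ℕ := (-⌊c⌋).toNat

/-- Admissibility of `c` and the pair `𝓕 = (F₁, F₂)`. -/
def IsAdmissible (c : ℝ) (F1 F2 : Finset ℕ) : Prop :=
  ∀ x : ℕ, 0 ≤ (∏ f ∈ F1, ((x : ℝ) - f)) * (∏ f ∈ F2, ((x : ℝ) + c + f)) /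
    poch ((x : ℝ) + c) (chat c)

/-- `u_𝓕 = ∑_{f∈F₁} f + ∑_{f∈F₂} f - C(k₁+1, 2) - C(k₂, 2)`. -/
def uF (F1 F2 : Finset ℕ) : ℕ :=
  (∑ f ∈ F1, f + ∑ f ∈ F2, f) - (Nat.choose (F1.card + 1) 2 + Nat.choose F2.card 2)

/-- `σ_𝓕 = {u_𝓕, u_𝓕+1, …} \ {u_𝓕 + f : f ∈ F₁}`. -/
def sigmaF (F1 F2 : Finset ℕ) : Set ℕ :=
  {n | uF F1 F2 ≤ n ∧ ∀ f ∈ F1, n ≠ uF F1 F2 + f}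

/-- The `i`-th element (0-based) of `F` in increasing order. -/
def nth (F : Finset ℕ) (i : ℕ) : ℕ := (F.sort (· ≤ ·)).getD i 0
/-- The Laguerre polynomial `L_n^α` as a real polynomial. -/
noncomputable def lag (α : ℝ) (n : ℕ) : Polynomial ℝ :=
  ∑ j ∈ Finset.range (n + 1),
    Polynomial.C ((-1 : ℝ) ^ j / (Nat.factorial j : ℝ) * gbinom ((n : ℝ) + α) (n - j)) *
      Polynomial.X ^ j

/-- `j`-th derivative of a real polynomial. -/
noncomputable def iterDeriv (j : ℕ) (p : Polynomial ℝ) : Polynomial ℝ :=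
  (fun q => Polynomial.derivative q)^[j] p

/-- The polynomial `L_n^{α;𝓕}` (Wronskian type determinant of Laguerre polynomials). -/
noncomputable def lagExc (α : ℝ) (F1 F2 : Finset ℕ) (n : ℕ) : Polynomial ℝ :=
  Matrix.det (Matrix.of fun i j : Fin (F1.card + F2.card + 1) =>
    if (i : ℕ) = 0 then iterDeriv (j : ℕ) (lag α (n - uF F1 F2))
    else if (i : ℕ) - 1 < F1.card then iterDeriv (j : ℕ) (lag α (nth F1 ((i : ℕ) - 1)))
    else (lag (α + ((j : ℕ) : ℝ)) (nth F2 ((i : ℕ) - 1 - F1.card))).comp (-Polynomial.X))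

/-- The Wronskian type determinant `Ω_𝓕^α` as a real polynomial. -/
noncomputable def OmegaL (α : ℝ) (F1 F2 : Finset ℕ) : Polynomial ℝ :=
  Matrix.det (Matrix.of fun i j : Fin (F1.card + F2.card) =>
    if (i : ℕ) < F1.card then iterDeriv (j : ℕ) (lag α (nth F1 (i : ℕ)))
    else (lag (α + ((j : ℕ) : ℝ)) (nth F2 ((i : ℕ) - F1.card))).comp (-Polynomial.X))


/-! ### Laguerre identities -/

lemma gbinom_zero (t : ℝ) : gbinom t 0 = 1 := by simp [gbinom]

lemma gbinom_absorb (t : ℝ) (m : ℕ) :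
    gbinom (t + 1) m * (t + 1 - m) = (t + 1) * gbinom t m := by
  have h1 : (∏ i ∈ Finset.range (m + 1), (t + 1 - (i : ℝ)))
      = (∏ i ∈ Finset.range m, (t + 1 - (i : ℝ))) * (t + 1 - m) := Finset.prod_range_succ _ _
  have h2 : (∏ i ∈ Finset.range (m + 1), (t + 1 - (i : ℝ)))
      = (∏ i ∈ Finset.range m, (t - (i : ℝ))) * (t + 1) := by
    rw [Finset.prod_range_succ']
    congr 1
    · apply Finset.prod_congr rfl
      intro i _
      push_cast; ring
    · simp
  unfold gbinom
  rw [div_mul_eq_mul_div, ← h1, h2]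
  ring

lemma gbinom_pascal (t : ℝ) (m : ℕ) :
    gbinom (t + 1) (m + 1) = gbinom t (m + 1) + gbinom t m := by
  have h2 : (∏ i ∈ Finset.range (m + 1), (t + 1 - (i : ℝ)))
      = (∏ i ∈ Finset.range m, (t - (i : ℝ))) * (t + 1) := by
    rw [Finset.prod_range_succ']
    congr 1
    · apply Finset.prod_congr rfl
      intro i _
      push_cast; ring
    · simp
  unfold gbinom
  rw [h2, Finset.prod_range_succ]
  have : (Nat.factorial m : ℝ) ≠ 0 := by positivity
  rw [Nat.factorial_succ]
  push_cast
  field_simp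
  ring

lemma lag_coeff (a : ℝ) (n j : ℕ) : (lag a n).coeff j =
    if j ≤ n then (-1 : ℝ) ^ j / (Nat.factorial j : ℝ) * gbinom ((n : ℝ) + a) (n - j) else 0 := by
  unfold lag
  simp only [Polynomial.finsetSum_coeff, Polynomial.coeff_C_mul_X_pow]
  by_cases h : j ≤ n
  · rw [if_pos h, Finset.sum_eq_single j]
    · simp
    · intro b _ hb
      rw [if_neg (Ne.symm hb)]
    · intro hj
      exact absurd (Finset.mem_range.mpr (by omega)) hj
  · rw [if_neg h]
    apply Finset.sum_eq_zero
    intro b hb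
    rw [if_neg]
    have := Finset.mem_range.mp hb
    omega

lemma lag_derivative (a : ℝ) (n : ℕ) :
    Polynomial.derivative (lag a n) = lag a n - lag (a + 1) n := by
  ext j
  rw [Polynomial.coeff_derivative, Polynomial.coeff_sub, lag_coeff, lag_coeff, lag_coeff]
  rcases lt_trichotomy j n with h | h | h
  · obtain ⟨m, rfl⟩ : ∃ m, n = j + 1 + m := ⟨n - j - 1, by omega⟩
    rw [if_pos (by omega), if_pos (by omega), if_pos (by omega)]
    have e1 : j + 1 + m - (j + 1) = m := by omega
    have e2 : j + 1 + m - j = m + 1 := by omega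
    rw [e1, e2, ← add_assoc, gbinom_pascal, Nat.factorial_succ]
    have : (Nat.factorial j : ℝ) ≠ 0 := by positivity
    push_cast
    field_simp
    ring
  · subst h
    simp [gbinom_zero]
  · rw [if_neg (by omega), if_neg (by omega), if_neg (by omega)]
    simp

lemma lag_lower (a : ℝ) (n : ℕ) :
    Polynomial.X * Polynomial.derivative (lag (a + 1) n) + Polynomial.C (a + 1) * lag (a + 1) n
      = Polynomial.C (n + a + 1) * lag a n := by
  ext j
  have key : (Polynomial.X * Polynomial.derivative (lag (a + 1) n)).coeff j
      = j * (lag (a + 1) n).coeff j := by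
    rcases j with _ | j
    · simp
    · rw [Polynomial.coeff_X_mul, Polynomial.coeff_derivative]
      push_cast; ring
  rw [Polynomial.coeff_add, key, Polynomial.coeff_C_mul, Polynomial.coeff_C_mul, lag_coeff,
    lag_coeff]
  by_cases h : j ≤ n
  · rw [if_pos h, if_pos h]
    have := gbinom_absorb (n + a) (n - j)
    rw [Nat.cast_sub h] at this
    rw [← add_assoc]
    have e : (n + a + 1 - (n - j) : ℝ) = j + a + 1 := by ring
    rw [e] at this
    linear_combination ((-1 : ℝ) ^ j / (Nat.factorial j : ℝ)) * this
  · rw [if_neg h, if_neg h]; simp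

lemma lag_three (a : ℝ) (n : ℕ) (x : ℝ) :
    x * (lag (a + 2) n).eval x - (x + a + 1) * (lag (a + 1) n).eval x
      + (n + a + 1) * (lag a n).eval x = 0 := by
  have h := congrArg (Polynomial.eval x) (lag_lower a n)
  rw [lag_derivative] at h
  simp only [Polynomial.eval_add, Polynomial.eval_mul, Polynomial.eval_sub, Polynomial.eval_C,
    Polynomial.eval_X] at h
  have e : a + 1 + 1 = a + 2 := by ring
  rw [e] at h
  linear_combination -h

lemma lag_three_poly (a : ℝ) (n : ℕ) :
    Polynomial.X * (lag (a + 2) n) - (Polynomial.X + Polynomial.C (a + 1)) * (lag (a + 1) n)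
      + Polynomial.C (n + a + 1) * (lag a n) = 0 := by
  apply Polynomial.funext
  intro x
  have := lag_three a n x
  simp only [Polynomial.eval_add, Polynomial.eval_mul, Polynomial.eval_sub, Polynomial.eval_C,
    Polynomial.eval_X, Polynomial.eval_zero]
  linear_combination this

lemma lag_top (a : ℝ) (n : ℕ) : (lag a n).coeff n ≠ 0 := by
  rw [lag_coeff, if_pos le_rfl, Nat.sub_self, gbinom_zero]
  have : (Nat.factorial n : ℝ) ≠ 0 := by positivity
  simp [this]

lemma lag_natDegree (a : ℝ) (n : ℕ) : (lag a n).natDegree = n := by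
  apply le_antisymm
  · rw [Polynomial.natDegree_le_iff_coeff_eq_zero]
    intro m hm
    rw [lag_coeff, if_neg (by omega)]
  · exact Polynomial.le_natDegree_of_ne_zero (lag_top a n)

lemma iterDeriv_zero (p : Polynomial ℝ) : iterDeriv 0 p = p := rfl

lemma iterDeriv_succ (j : ℕ) (p : Polynomial ℝ) :
    iterDeriv (j + 1) p = Polynomial.derivative (iterDeriv j p) := by
  unfold iterDeriv
  rw [Function.iterate_succ_apply']

lemma iterDeriv_succ' (j : ℕ) (p : Polynomial ℝ) :
    iterDeriv (j + 1) p = iterDeriv j (Polynomial.derivative p) := by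
  unfold iterDeriv
  rw [Function.iterate_succ_apply]

lemma iterDeriv_sub (j : ℕ) (p q : Polynomial ℝ) :
    iterDeriv j (p - q) = iterDeriv j p - iterDeriv j q := by
  induction j with
  | zero => rfl
  | succ j ih => rw [iterDeriv_succ, iterDeriv_succ, iterDeriv_succ, ih, Polynomial.derivative_sub]

lemma iterDeriv_top (p : Polynomial ℝ) (x : ℝ) (hp : p ≠ 0) :
    (iterDeriv p.natDegree p).eval x ≠ 0 := by
  have h : iterDeriv p.natDegree p = Polynomial.derivative^[p.natDegree] p := rfl
  have hd : (Polynomial.derivative^[p.natDegree] p).natDegree ≤ 0 := by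
    have := Polynomial.natDegree_iterate_derivative p p.natDegree
    omega
  rw [h, Polynomial.eq_C_of_natDegree_le_zero hd, Polynomial.eval_C,
    Polynomial.coeff_iterate_derivative, zero_add, Nat.descFactorial_self, nsmul_eq_mul]
  have h1 : (Nat.factorial p.natDegree : ℝ) ≠ 0 := by positivity
  exact mul_ne_zero h1 (Polynomial.leadingCoeff_ne_zero.mpr hp)

/-! ### Towers of eigenfunctions -/

/-- `φ i = (∂ - 1)^i φ 0`, with `φ 0` an eigenfunction of the Laguerre operator. -/
def IsTower (c lam : ℝ) (φ : ℕ → ℝ → ℝ) : Prop :=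
  (∀ i x, HasDerivAt (φ i) (φ i x + φ (i + 1) x) x) ∧
  ∀ (i : ℕ) (x : ℝ),
    x * φ (i + 2) x + (x + c + i) * φ (i + 1) x + (lam + c + i) * φ i x = 0

noncomputable def towA (α : ℝ) (n : ℕ) (i : ℕ) (x : ℝ) : ℝ := (-1) ^ i * (lag (α + i) n).eval x

noncomputable def towB (α : ℝ) (f : ℕ) (i : ℕ) (x : ℝ) : ℝ :=
  Real.exp x * (iterDeriv i ((lag α f).comp (-Polynomial.X))).eval x

lemma towA_tower (α : ℝ) (n : ℕ) : IsTower (α + 1) n (towA α n) := by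
  constructor
  · intro i x
    unfold towA
    have h := ((lag (α + i) n).hasDerivAt x).const_mul ((-1 : ℝ) ^ i)
    rw [lag_derivative] at h
    refine h.congr_deriv ?_
    have e : α + ((i + 1 : ℕ) : ℝ) = α + i + 1 := by push_cast; ring
    rw [e, pow_succ]
    simp only [Polynomial.eval_sub]
    ring
  · intro i x
    unfold towA
    have h := lag_three (α + i) n x
    have e : α + ((i + 1 : ℕ) : ℝ) = α + i + 1 := by push_cast; ring
    have e2 : α + ((i + 2 : ℕ) : ℝ) = α + i + 2 := by push_cast; ring
    rw [e, e2, pow_succ, pow_add]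
    linear_combination (-1 : ℝ) ^ i * h

lemma lagneg_derivative (a : ℝ) (n : ℕ) :
    Polynomial.derivative ((lag a n).comp (-Polynomial.X)) =
      (lag (a + 1) n).comp (-Polynomial.X) - (lag a n).comp (-Polynomial.X) := by
  rw [Polynomial.derivative_comp, lag_derivative]
  simp

lemma lagneg_ode (a : ℝ) (f i : ℕ) :
    Polynomial.X * iterDeriv (i + 2) ((lag a f).comp (-Polynomial.X))
      + (Polynomial.X + Polynomial.C (a + 1 + i)) *
        iterDeriv (i + 1) ((lag a f).comp (-Polynomial.X))
      + Polynomial.C (-(f : ℝ) + i) * iterDeriv i ((lag a f).comp (-Polynomial.X)) = 0 := by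
  induction i with
  | zero =>
    have e : a + 1 + 1 = a + 2 := by ring
    simp only [iterDeriv_succ, iterDeriv_zero, lagneg_derivative, Polynomial.derivative_sub, e]
    have h := congrArg (fun p => p.comp (-Polynomial.X)) (lag_three_poly a f)
    simp only [Polynomial.add_comp, Polynomial.sub_comp, Polynomial.mul_comp, Polynomial.X_comp,
      Polynomial.C_comp, Polynomial.zero_comp] at h
    simp only [Polynomial.C_add, Polynomial.C_neg, Nat.cast_zero, Polynomial.C_0] at h ⊢
    linear_combination -h
  | succ i ih =>
    have h := congrArg Polynomial.derivative ih
    simp only [Polynomial.derivative_add, Polynomial.derivative_mul, Polynomial.derivative_X,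
      Polynomial.derivative_C, ← iterDeriv_succ, Polynomial.derivative_zero] at h
    push_cast
    simp only [Polynomial.C_add, Polynomial.C_neg, Polynomial.C_1] at h ⊢
    linear_combination h

lemma towB_tower (α : ℝ) (f : ℕ) : IsTower (α + 1) (-(α + 1 + f)) (towB α f) := by
  constructor
  · intro i x
    unfold towB
    have h := (Real.hasDerivAt_exp x).mul
      ((iterDeriv i ((lag α f).comp (-Polynomial.X))).hasDerivAt x)
    rw [← iterDeriv_succ] at h
    exact h
  · intro i x
    unfold towB
    have h := congrArg (Polynomial.eval x) (lagneg_ode α f i)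
    simp only [Polynomial.eval_add, Polynomial.eval_mul, Polynomial.eval_C,
      Polynomial.eval_X, Polynomial.eval_zero] at h
    linear_combination Real.exp x * h


/-! ### Algebra of jets -/

lemma jets_pow {k : ℕ} {c x0 : ℝ} {lam : Fin k → ℝ} {φ : Fin k → ℕ → ℝ → ℝ}
    (hφ : ∀ f, IsTower c (lam f) (φ f)) {b : Fin k → ℝ} (N : ℕ)
    (H : ∀ i < N, ∑ f, b f * φ f i x0 = 0) (a : ℕ) :
    ∀ i, i + 2 * a < N → ∑ f, b f * lam f ^ a * φ f i x0 = 0 := by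
  induction a with
  | zero => intro i hi; simpa using H i (by omega)
  | succ a ih =>
    intro i hi
    have h0 := ih i (by omega)
    have h1 := ih (i + 1) (by omega)
    have h2 := ih (i + 2) (by omega)
    have : ∑ f, b f * lam f ^ (a + 1) * φ f i x0 =
        -(x0 * ∑ f, b f * lam f ^ a * φ f (i + 2) x0
          + (x0 + c + i) * ∑ f, b f * lam f ^ a * φ f (i + 1) x0
          + (c + i) * ∑ f, b f * lam f ^ a * φ f i x0) := by
      simp only [Finset.mul_sum, ← Finset.sum_add_distrib, ← Finset.sum_neg_distrib]
      apply Finset.sum_congr rfl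
      intro f _
      have := (hφ f).2 i x0
      rw [pow_succ]
      linear_combination b f * lam f ^ a * this
    rw [this, h0, h1, h2]; simp

lemma jets_pow_zero {k : ℕ} {c : ℝ} {lam : Fin k → ℝ} {φ : Fin k → ℕ → ℝ → ℝ}
    (hφ : ∀ f, IsTower c (lam f) (φ f)) {b : Fin k → ℝ} (N : ℕ)
    (H : ∀ i < N, ∑ f, b f * φ f i 0 = 0) (a : ℕ) :
    ∀ i, i + a < N → ∑ f, b f * lam f ^ a * φ f i 0 = 0 := by
  induction a with
  | zero => intro i hi; simpa using H i (by omega)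
  | succ a ih =>
    intro i hi
    have h0 := ih i (by omega)
    have h1 := ih (i + 1) (by omega)
    have : ∑ f, b f * lam f ^ (a + 1) * φ f i 0 =
        -((c + i) * ∑ f, b f * lam f ^ a * φ f (i + 1) 0
          + (c + i) * ∑ f, b f * lam f ^ a * φ f i 0) := by
      simp only [Finset.mul_sum, ← Finset.sum_add_distrib, ← Finset.sum_neg_distrib]
      apply Finset.sum_congr rfl
      intro f _
      have := (hφ f).2 i 0
      rw [pow_succ]
      linear_combination b f * lam f ^ a * this
    rw [this, h0, h1]; simp

/-- Span of the sequences `n ↦ v n j x0`, `j < m`. -/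
def Sp (v : ℕ → ℕ → ℝ → ℝ) (x0 : ℝ) (m : ℕ) : Submodule ℝ (ℕ → ℝ) :=
  Submodule.span ℝ (Set.image (fun (j : ℕ) (n : ℕ) => v n j x0) (Set.Iio m))

lemma Sp_mono (v : ℕ → ℕ → ℝ → ℝ) (x0 : ℝ) {m m' : ℕ} (h : m ≤ m') : Sp v x0 m ≤ Sp v x0 m' := by
  apply Submodule.span_mono
  apply Set.image_mono
  exact Set.Iio_subset_Iio h

lemma Sp_pow {c : ℝ} {v : ℕ → ℕ → ℝ → ℝ} (hv : ∀ n : ℕ, IsTower c n (v n)) (x0 : ℝ) (a : ℕ) :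
    ∀ i, (fun n : ℕ => (n : ℝ) ^ a * v n i x0) ∈ Sp v x0 (i + 2 * a + 1) := by
  induction a with
  | zero =>
    intro i
    apply Submodule.subset_span
    exact ⟨i, by simp, by funext n; simp⟩
  | succ a ih =>
    intro i
    have h0 := Sp_mono v x0 (show i + 2 * a + 1 ≤ i + 2 * (a + 1) + 1 by omega) (ih i)
    have h1 := Sp_mono v x0 (show i + 1 + 2 * a + 1 ≤ i + 2 * (a + 1) + 1 by omega) (ih (i + 1))
    have h2 := Sp_mono v x0 (show i + 2 + 2 * a + 1 ≤ i + 2 * (a + 1) + 1 by omega) (ih (i + 2))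
    have h := Submodule.neg_mem _ (Submodule.add_mem _ (Submodule.add_mem _
      (Submodule.smul_mem _ x0 h2) (Submodule.smul_mem _ (x0 + c + i) h1))
      (Submodule.smul_mem _ (c + i) h0))
    convert h using 1
    funext n
    simp only [Pi.neg_apply, Pi.add_apply, Pi.smul_apply, smul_eq_mul]
    have := (hv n).2 i x0
    rw [pow_succ]
    linear_combination (n : ℝ) ^ a * this

lemma divided_diff {k : ℕ} (lam : Fin k → ℝ) (f : Fin k) (y : ℝ) :
    ∏ f' ∈ Finset.univ.erase f, (y - lam f') =
      ∑ m ∈ Finset.range (k + 1),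
        (∏ f', (Polynomial.X - Polynomial.C (lam f'))).coeff m *
          ∑ a ∈ Finset.range m, y ^ a * lam f ^ (m - 1 - a) := by
  set p : Polynomial ℝ := ∏ f', (Polynomial.X - Polynomial.C (lam f')) with hp
  have hdeg : p.natDegree = k := by
    rw [hp, Polynomial.natDegree_prod_of_monic _ _ (fun i _ => Polynomial.monic_X_sub_C _)]
    simp
  have e1 : p = (∏ f' ∈ Finset.univ.erase f, (Polynomial.X - Polynomial.C (lam f'))) *
      (Polynomial.X - Polynomial.C (lam f)) := by
    rw [hp, Finset.prod_erase_mul _ _ (Finset.mem_univ f)]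
  have hroot : p.eval (lam f) = 0 := by rw [e1]; simp
  have e2 : p = (∑ m ∈ Finset.range (k + 1), Polynomial.C (p.coeff m) *
        ∑ a ∈ Finset.range m, Polynomial.X ^ a * (Polynomial.C (lam f)) ^ (m - 1 - a)) *
      (Polynomial.X - Polynomial.C (lam f)) := by
    rw [Finset.sum_mul]
    have : ∀ m ∈ Finset.range (k + 1), Polynomial.C (p.coeff m) *
        (∑ a ∈ Finset.range m, Polynomial.X ^ a * (Polynomial.C (lam f)) ^ (m - 1 - a)) *
        (Polynomial.X - Polynomial.C (lam f)) =
        Polynomial.C (p.coeff m) * Polynomial.X ^ m - Polynomial.C (p.coeff m * lam f ^ m) := by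
      intro m _
      rw [mul_assoc, (Commute.all _ _).geom_sum₂_mul]
      simp [mul_sub]
    rw [Finset.sum_congr rfl this, Finset.sum_sub_distrib]
    have h1 : ∑ m ∈ Finset.range (k + 1), Polynomial.C (p.coeff m) * Polynomial.X ^ m = p := by
      rw [← hdeg]; exact (Polynomial.as_sum_range_C_mul_X_pow p).symm
    have h2 : ∑ m ∈ Finset.range (k + 1), Polynomial.C (p.coeff m * lam f ^ m) = 0 := by
      rw [← map_sum, ← hdeg, ← Polynomial.eval_eq_sum_range, hroot, Polynomial.C_0]
    rw [h1, h2, sub_zero]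
  have e3 := mul_right_cancel₀ (Polynomial.X_sub_C_ne_zero (lam f)) (e1.symm.trans e2)
  have e4 := congrArg (Polynomial.eval y) e3
  simpa [Polynomial.eval_prod, Polynomial.eval_finsetSum] using e4

/-- Concomitant. -/
noncomputable def conc (φ v : ℕ → ℝ → ℝ) (i : ℕ) (x : ℝ) : ℝ :=
  φ i x * v (i + 1) x - v i x * φ (i + 1) x

noncomputable def DD {k : ℕ} (lam : Fin k → ℝ) (φ : Fin k → ℕ → ℝ → ℝ) (b : Fin k → ℝ)
    (v : ℕ → ℕ → ℝ → ℝ) (x0 : ℝ) (i : ℕ) (n : ℕ) : ℝ :=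
  ∑ f, b f * (∏ f' ∈ Finset.univ.erase f, ((n : ℝ) - lam f')) * conc (φ f) (v n) i x0

lemma DD_mem {k : ℕ} {c x0 : ℝ} {lam : Fin k → ℝ} {φ : Fin k → ℕ → ℝ → ℝ}
    (hφ : ∀ f, IsTower c (lam f) (φ f)) {b : Fin k → ℝ}
    {v : ℕ → ℕ → ℝ → ℝ} (hv : ∀ n : ℕ, IsTower c n (v n))
    (H : ∀ i < k, ∑ f, b f * φ f i x0 = 0) : DD lam φ b v x0 0 ∈ Sp v x0 k := by
  set p : Polynomial ℝ := ∏ f', (Polynomial.X - Polynomial.C (lam f')) with hp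
  have e : DD lam φ b v x0 0 = ∑ m ∈ Finset.range (k + 1), ∑ a ∈ Finset.range m,
      (p.coeff m) • ((∑ f, b f * lam f ^ (m - 1 - a) * φ f 0 x0) •
          (fun n : ℕ => (n : ℝ) ^ a * v n 1 x0)
        - (∑ f, b f * lam f ^ (m - 1 - a) * φ f 1 x0) • (fun n : ℕ => (n : ℝ) ^ a * v n 0 x0)) := by
    funext n
    simp only [Finset.sum_apply, Pi.smul_apply, Pi.sub_apply, smul_eq_mul, DD, conc]
    simp_rw [divided_diff, ← hp]
    simp only [Finset.mul_sum, Finset.sum_mul, ← Finset.sum_sub_distrib]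
    rw [Finset.sum_comm]
    apply Finset.sum_congr rfl
    intro m _
    rw [Finset.sum_comm]
    apply Finset.sum_congr rfl
    intro a _
    apply Finset.sum_congr rfl
    intro f _
    ring
  rw [e]
  refine Submodule.sum_mem _ fun m hm => Submodule.sum_mem _ fun a ha =>
    Submodule.smul_mem _ _ (Submodule.sub_mem _ ?_ ?_)
  · have hm' := Finset.mem_range.mp hm
    have ha' := Finset.mem_range.mp ha
    by_cases hb : 0 + 2 * (m - 1 - a) < k
    · rw [jets_pow hφ k H _ 0 hb, zero_smul]; exact Submodule.zero_mem _
    · exact Submodule.smul_mem _ _ (Sp_mono v x0 (by omega) (Sp_pow hv x0 a 1))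
  · have hm' := Finset.mem_range.mp hm
    have ha' := Finset.mem_range.mp ha
    by_cases hb : 1 + 2 * (m - 1 - a) < k
    · rw [jets_pow hφ k H _ 1 hb, zero_smul]; exact Submodule.zero_mem _
    · exact Submodule.smul_mem _ _ (Sp_mono v x0 (by omega) (Sp_pow hv x0 a 0))

lemma conc_step {c lam nu : ℝ} {φ v : ℕ → ℝ → ℝ} (hφ : IsTower c lam φ) (hv : IsTower c nu v)
    (i : ℕ) (x : ℝ) :
    x * conc φ v (i + 1) x = (nu + c + i) * conc φ v i x - (nu - lam) * φ i x * v (i + 1) x := by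
  have h1 := hφ.2 i x
  have h2 := hv.2 i x
  unfold conc
  rw [show i + 1 + 1 = i + 2 from rfl]
  linear_combination φ (i + 1) x * h2 - v (i + 1) x * h1

lemma DD_step {k : ℕ} {c x0 : ℝ} {lam : Fin k → ℝ} {φ : Fin k → ℕ → ℝ → ℝ}
    (hφ : ∀ f, IsTower c (lam f) (φ f)) {b : Fin k → ℝ}
    {v : ℕ → ℕ → ℝ → ℝ} (hv : ∀ n : ℕ, IsTower c n (v n))
    (H : ∀ i < k, ∑ f, b f * φ f i x0 = 0) (n : ℕ) (i : ℕ) (hi : i ≤ k) :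
    x0 ^ i * DD lam φ b v x0 i n =
      (∏ j ∈ Finset.range i, ((n : ℝ) + c + j)) * DD lam φ b v x0 0 n := by
  induction i with
  | zero => simp
  | succ i ih =>
    have h := ih (by omega)
    have step : x0 * DD lam φ b v x0 (i + 1) n = (n + c + i) * DD lam φ b v x0 i n := by
      have h0 : (∏ f', ((n : ℝ) - lam f')) * v n (i + 1) x0 * ∑ f, b f * φ f i x0 = 0 := by
        rw [H i (by omega), mul_zero]
      rw [← sub_zero ((n + c + i) * DD lam φ b v x0 i n), ← h0]
      unfold DD
      simp only [Finset.mul_sum, ← Finset.sum_sub_distrib]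
      apply Finset.sum_congr rfl
      intro f _
      have h1 := conc_step (hφ f) (hv n) i x0
      rw [← Finset.mul_prod_erase Finset.univ (fun f' => (n : ℝ) - lam f') (Finset.mem_univ f)]
      linear_combination b f * (∏ f' ∈ Finset.univ.erase f, ((n : ℝ) - lam f')) * h1
    rw [Finset.prod_range_succ, pow_succ, mul_assoc, step]
    linear_combination (n + c + i : ℝ) * h


/-! ### The Laguerre weight and completeness -/

noncomputable def wtL (a x : ℝ) : ℝ := x ^ (a - 1) * Real.exp (-x)

noncomputable def muL (a : ℝ) : Measure ℝ :=
  (volume.restrict (Set.Ioi 0)).withDensity (fun x => ENNReal.ofReal (wtL a x))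

lemma wtL_meas (a : ℝ) : Measurable (wtL a) := by unfold wtL; fun_prop

lemma wtL_pos (a : ℝ) {x : ℝ} (hx : 0 < x) : 0 < wtL a x := by unfold wtL; positivity

lemma integrable_muL (a : ℝ) (f : ℝ → ℝ) :
    Integrable f (muL a) ↔ IntegrableOn (fun x => wtL a x * f x) (Set.Ioi 0) := by
  unfold muL
  rw [integrable_withDensity_iff_integrable_smul' (wtL_meas a).ennreal_ofReal (by simp)]
  apply integrable_congr
  filter_upwards [ae_restrict_mem measurableSet_Ioi] with x hx
  rw [ENNReal.toReal_ofReal (wtL_pos a hx).le, smul_eq_mul]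

lemma integral_muL (a : ℝ) (f : ℝ → ℝ) :
    ∫ x, f x ∂(muL a) = ∫ x in Set.Ioi 0, wtL a x * f x := by
  unfold muL
  rw [integral_withDensity_eq_integral_toReal_smul (wtL_meas a).ennreal_ofReal (by simp)]
  apply integral_congr_ae
  filter_upwards [ae_restrict_mem measurableSet_Ioi] with x hx
  rw [ENNReal.toReal_ofReal (wtL_pos a hx).le, smul_eq_mul]

lemma ae_muL (a : ℝ) (p : ℝ → Prop) :
    (∀ᵐ x ∂(muL a), p x) ↔ ∀ᵐ x ∂(volume.restrict (Set.Ioi 0)), p x := by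
  unfold muL
  rw [ae_withDensity_iff (wtL_meas a).ennreal_ofReal]
  constructor
  · intro h
    filter_upwards [h, ae_restrict_mem measurableSet_Ioi] with x hx h0
    apply hx
    simpa using wtL_pos a h0
  · intro h
    filter_upwards [h] with x hx _ using hx

lemma integrable_pow_exp {a : ℝ} (ha : 0 < a) (n : ℕ) {t : ℝ} (ht : t < 1) :
    Integrable (fun x => x ^ n * Real.exp (t * x)) (muL a) := by
  rw [integrable_muL]
  have h := integrableOn_rpow_mul_exp_neg_mul_rpow (p := 1) (s := a - 1 + n) (b := 1 - t)
    (by have : (0 : ℝ) ≤ n := Nat.cast_nonneg n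
        linarith) one_pos (by linarith)
  refine h.congr_fun ?_ measurableSet_Ioi
  intro x hx
  have hx : (0 : ℝ) < x := hx
  simp only [wtL, Real.rpow_one]
  rw [Real.rpow_add hx, Real.rpow_natCast, show -(1 - t) * x = -x + t * x by ring, Real.exp_add]
  ring

instance muL_finite {a : ℝ} [Fact (0 < a)] : IsFiniteMeasure (muL a) := by
  have h := integrable_pow_exp (a := a) Fact.out 0 (t := 0) (by norm_num)
  simp only [pow_zero, zero_mul, Real.exp_zero, mul_one] at h
  rw [integrable_const_iff] at h
  simpa using h

lemma integrable_poly {a : ℝ} (ha : 0 < a) (p : Polynomial ℝ) :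
    Integrable (fun x => p.eval x) (muL a) := by
  simp_rw [Polynomial.eval_eq_sum_range]
  apply integrable_finsetSum
  intro i _
  apply Integrable.const_mul
  simpa using integrable_pow_exp ha i (t := 0) (by norm_num)

lemma memLp_poly {a : ℝ} (ha : 0 < a) (p : Polynomial ℝ) :
    MemLp (fun x => p.eval x) 2 (muL a) := by
  rw [memLp_two_iff_integrable_sq p.continuous.aestronglyMeasurable]
  have h := integrable_poly ha (p ^ 2)
  simp only [Polynomial.eval_pow] at h
  exact h

lemma memLp_exp {a : ℝ} (ha : 0 < a) {t : ℝ} (ht : t < 1 / 2) :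
    MemLp (fun x => Real.exp (t * x)) 2 (muL a) := by
  rw [memLp_two_iff_integrable_sq (by fun_prop)]
  have := integrable_pow_exp ha 0 (t := 2 * t) (by linarith)
  refine this.congr (Filter.Eventually.of_forall fun x => ?_)
  simp only [pow_zero, one_mul]
  rw [← Real.exp_nat_mul]
  push_cast; ring_nf

lemma complexMGF_eq_of_moments {ν₁ ν₂ : Measure ℝ} [IsFiniteMeasure ν₁] [IsFiniteMeasure ν₂]
    (h1 : ∀ t : ℝ, |t| < 1 / 2 → Integrable (fun x => Real.exp (t * x)) ν₁)
    (h2 : ∀ t : ℝ, |t| < 1 / 2 → Integrable (fun x => Real.exp (t * x)) ν₂)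
    (hm : ∀ n : ℕ, ∫ x, x ^ n ∂ν₁ = ∫ x, x ^ n ∂ν₂) : ν₁ = ν₂ := by
  have hI : ∀ ν : Measure ℝ, (∀ t : ℝ, |t| < 1 / 2 → Integrable (fun x => Real.exp (t * x)) ν) →
      Set.Ioo (-(1 / 2) : ℝ) (1 / 2) ⊆ interior (ProbabilityTheory.integrableExpSet id ν) := by
    intro ν h
    apply interior_maximal _ isOpen_Ioo
    intro t ht
    exact h t (abs_lt.mpr ht)
  set U : Set ℂ := Complex.re ⁻¹' Set.Ioo (-(1 / 2) : ℝ) (1 / 2) with hU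
  have hA : ∀ ν : Measure ℝ, (∀ t : ℝ, |t| < 1 / 2 → Integrable (fun x => Real.exp (t * x)) ν) →
      AnalyticOnNhd ℂ (ProbabilityTheory.complexMGF id ν) U := by
    intro ν h z hz
    exact ProbabilityTheory.analyticAt_complexMGF (hI ν h hz)
  have h0 : (0 : ℂ) ∈ U := by simp [hU]
  have hpre : IsPreconnected U := by
    apply Convex.isPreconnected
    exact (convex_Ioo _ _).linear_preimage Complex.reLm
  have hser : ∀ n, iteratedDeriv n (ProbabilityTheory.complexMGF id ν₁) 0
      = iteratedDeriv n (ProbabilityTheory.complexMGF id ν₂) 0 := by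
    intro n
    rw [ProbabilityTheory.iteratedDeriv_complexMGF (hI ν₁ h1 (by simp)),
      ProbabilityTheory.iteratedDeriv_complexMGF (hI ν₂ h2 (by simp))]
    have e : ∀ ν : Measure ℝ, ∫ x : ℝ, ((id x : ℝ) : ℂ) ^ n * Complex.exp (0 * ((id x : ℝ) : ℂ)) ∂ν
        = ((∫ x : ℝ, x ^ n ∂ν : ℝ) : ℂ) := by
      intro ν
      rw [← integral_complex_ofReal]
      congr 1
      funext x
      simp
    rw [e, e, hm]
  have hev : ProbabilityTheory.complexMGF id ν₁ =ᶠ[nhds 0] ProbabilityTheory.complexMGF id ν₂ := by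
    have a1 := (hA ν₁ h1 0 h0).hasFPowerSeriesAt
    have a2 := (hA ν₂ h2 0 h0).hasFPowerSeriesAt
    simp only [hser] at a1
    filter_upwards [a1.eventually_hasSum_sub, a2.eventually_hasSum_sub] with z hz1 hz2
    exact hz1.unique hz2
  have heq := (hA ν₁ h1).eqOn_of_preconnected_of_eventuallyEq (hA ν₂ h2) hpre h0 hev
  apply Measure.ext_of_charFun
  funext t
  rw [← ProbabilityTheory.complexMGF_id_mul_I, ← ProbabilityTheory.complexMGF_id_mul_I]
  apply heq
  simp [hU]

lemma complete_muL {a : ℝ} (ha : 0 < a) {f : ℝ → ℝ} (hf : MemLp f 2 (muL a))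
    (h : ∀ n : ℕ, ∫ x, f x * x ^ n ∂(muL a) = 0) : f =ᵐ[muL a] 0 := by
  have : Fact (0 < a) := ⟨ha⟩
  have hfi : Integrable f (muL a) := hf.integrable (by norm_num)
  have hfm : AEMeasurable f (muL a) := hfi.aemeasurable
  have hpos : ∀ g : ℝ → ℝ, Integrable (fun x => f x * g x) (muL a) → AEStronglyMeasurable g (muL a) →
      Integrable (fun x => (ENNReal.ofReal (f x)).toReal • g x) (muL a) ∧
      Integrable (fun x => (ENNReal.ofReal (-f x)).toReal • g x) (muL a) := by
    intro g hg hgm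
    constructor
    · refine hg.mono (hfm.ennreal_ofReal.ennreal_toReal.aestronglyMeasurable.smul hgm) (Filter.Eventually.of_forall fun x => ?_)
      rw [norm_smul, norm_mul]
      gcongr
      simp only [ENNReal.toReal_ofReal', Real.norm_eq_abs]
      rcases le_total (f x) 0 with h | h
      · rw [max_eq_right h]; simp
      · rw [max_eq_left h]
    · refine hg.mono (hfm.neg.ennreal_ofReal.ennreal_toReal.aestronglyMeasurable.smul hgm) (Filter.Eventually.of_forall fun x => ?_)
      rw [norm_smul, norm_mul]
      gcongr
      simp only [ENNReal.toReal_ofReal', Real.norm_eq_abs]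
      rcases le_total (f x) 0 with h | h
      · rw [max_eq_left (by linarith), abs_neg]
      · rw [max_eq_right (by linarith)]; simp
  set ν₁ := (muL a).withDensity (fun x => ENNReal.ofReal (f x)) with hν₁
  set ν₂ := (muL a).withDensity (fun x => ENNReal.ofReal (-f x)) with hν₂
  have : IsFiniteMeasure ν₁ := isFiniteMeasure_withDensity_ofReal hfi.2
  have : IsFiniteMeasure ν₂ := isFiniteMeasure_withDensity_ofReal hfi.neg.2
  have hexp : ∀ t : ℝ, |t| < 1 / 2 → Integrable (fun x => f x * Real.exp (t * x)) (muL a) := by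
    intro t ht
    exact hf.integrable_mul (memLp_exp ha (abs_lt.mp ht).2)
  have hpow : ∀ n : ℕ, Integrable (fun x => f x * x ^ n) (muL a) := by
    intro n
    have := memLp_poly ha (Polynomial.X ^ n)
    simp only [Polynomial.eval_pow, Polynomial.eval_X] at this
    exact hf.integrable_mul this
  have hνeq : ν₁ = ν₂ := by
    apply complexMGF_eq_of_moments
    · intro t ht
      rw [hν₁, integrable_withDensity_iff_integrable_smul₀' (by fun_prop) (by simp)]
      exact (hpos _ (hexp t ht) (by fun_prop)).1
    · intro t ht
      rw [hν₂, integrable_withDensity_iff_integrable_smul₀' (by fun_prop) (by simp)]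
      exact (hpos _ (hexp t ht) (by fun_prop)).2
    · intro n
      rw [hν₁, hν₂, integral_withDensity_eq_integral_toReal_smul₀ (by fun_prop) (by simp),
        integral_withDensity_eq_integral_toReal_smul₀ (by fun_prop) (by simp), ← sub_eq_zero,
        ← integral_sub (hpos _ (hpow n) (by fun_prop)).1 (hpos _ (hpow n) (by fun_prop)).2, ← h n]
      apply integral_congr_ae
      refine Filter.Eventually.of_forall fun x => ?_
      simp only [ENNReal.toReal_ofReal', smul_eq_mul]
      rcases le_total (f x) 0 with h | h
      · rw [max_eq_right h, max_eq_left (by linarith)]; ring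
      · rw [max_eq_left h, max_eq_right (by linarith)]; ring
  have hae := (withDensity_eq_iff (by fun_prop) (by fun_prop)
    (by have := measure_ne_top ν₁ Set.univ
        rwa [hν₁, withDensity_apply _ MeasurableSet.univ, Measure.restrict_univ] at this)).mp hνeq
  filter_upwards [hae] with x hx
  have := congrArg ENNReal.toReal hx
  simp only [ENNReal.toReal_ofReal'] at this
  rcases le_total (f x) 0 with h | h
  · rw [max_eq_right h, max_eq_left (by linarith)] at this
    simp; linarith
  · rw [max_eq_left h, max_eq_right (by linarith)] at this
    simp; linarith


/-! ### Green identities -/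

lemma conc_hasDerivAt {c lam nu : ℝ} {φ v : ℕ → ℝ → ℝ} (hφ : IsTower c lam φ) (hv : IsTower c nu v)
    (i : ℕ) {x : ℝ} (hx : 0 < x) :
    HasDerivAt (fun x => x ^ (c + i) * Real.exp (-x) * conc φ v i x)
      (-(nu - lam) * (wtL (c + i) x * (φ i x * v i x))) x := by
  have h1 := (Real.hasDerivAt_rpow_const (p := c + i) (Or.inl hx.ne'))
  have h2 : HasDerivAt (fun x => Real.exp (-x)) (-Real.exp (-x)) x := by
    simpa using (hasDerivAt_id x).neg.exp
  have h3 : HasDerivAt (conc φ v i) ((φ i x + φ (i + 1) x) * v (i + 1) x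
      + φ i x * (v (i + 1) x + v (i + 1 + 1) x) - ((v i x + v (i + 1) x) * φ (i + 1) x
      + v i x * (φ (i + 1) x + φ (i + 1 + 1) x))) x :=
    ((hφ.1 i x).mul (hv.1 (i + 1) x)).sub ((hv.1 i x).mul (hφ.1 (i + 1) x))
  refine ((h1.mul h2).mul h3).congr_deriv ?_
  have e : x ^ (c + i) = x ^ (c + i - 1) * x := by
    rw [Real.rpow_sub_one hx.ne']; field_simp
  have r1 := hφ.2 i x
  have r2 := hv.2 i x
  simp only [wtL, conc, Pi.mul_apply]
  rw [e]
  linear_combination x ^ (c + i - 1) * Real.exp (-x) * (φ i x * r2 - v i x * r1)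

lemma tower_cont {c lam : ℝ} {φ : ℕ → ℝ → ℝ} (hφ : IsTower c lam φ) (i : ℕ) : Continuous (φ i) :=
  continuous_iff_continuousAt.mpr fun x => (hφ.1 i x).continuousAt

lemma wtL_intervalIntegrable {a x0 : ℝ} (ha : 0 < a) {g : ℝ → ℝ} (hg : Continuous g) :
    IntervalIntegrable (fun x => wtL a x * g x) volume 0 x0 := by
  unfold wtL
  have := (intervalIntegral.intervalIntegrable_rpow' (a := 0) (b := x0) (r := a - 1)
    (by linarith)).mul_continuousOn (g := fun x => Real.exp (-x) * g x) (by fun_prop)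
  simpa [mul_assoc] using this

lemma green {c lam nu : ℝ} {φ v : ℕ → ℝ → ℝ} (hφ : IsTower c lam φ) (hv : IsTower c nu v)
    (i : ℕ) (ha : 0 < c + i) {x0 : ℝ} (hx0 : 0 < x0) :
    (nu - lam) * ∫ x in (0 : ℝ)..x0, wtL (c + i) x * (φ i x * v i x) =
      -(x0 ^ (c + i) * Real.exp (-x0) * conc φ v i x0) := by
  have hcφ := tower_cont hφ
  have hcv := tower_cont hv
  have hI := wtL_intervalIntegrable (x0 := x0) ha ((hcφ i).mul (hcv i))
  have := intervalIntegral.integral_eq_sub_of_hasDerivAt_of_le hx0.le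
    (f := fun x => x ^ (c + i) * Real.exp (-x) * conc φ v i x)
    (by
      apply ContinuousOn.mul
      · apply ContinuousOn.mul
        · exact (Real.continuous_rpow_const ha.le).continuousOn
        · fun_prop
      · unfold conc
        exact (((hcφ i).mul (hcv (i+1))).sub ((hcv i).mul (hcφ (i+1)))).continuousOn)
    (fun x hx => conc_hasDerivAt hφ hv i hx.1) (hI.const_mul _)
  rw [intervalIntegral.integral_const_mul, Real.zero_rpow ha.ne'] at this
  linear_combination -this

lemma integral_trunc {a x0 : ℝ} (hx0 : 0 < x0) (g w : ℝ → ℝ) :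
    ∫ x, (Set.Ioc 0 x0).indicator g x * w x ∂(muL a) =
      ∫ x in (0 : ℝ)..x0, wtL a x * (g x * w x) := by
  rw [integral_muL, intervalIntegral.integral_of_le hx0.le]
  have : (fun x => wtL a x * ((Set.Ioc 0 x0).indicator g x * w x)) =
      (Set.Ioc 0 x0).indicator (fun x => wtL a x * (g x * w x)) := by
    funext x
    by_cases hx : x ∈ Set.Ioc 0 x0 <;> simp [hx]
  rw [this, setIntegral_indicator measurableSet_Ioc]
  congr 2
  ext x
  simp

lemma decay (s : ℝ) (p : Polynomial ℝ) :
    Filter.Tendsto (fun x => x ^ s * Real.exp (-x) * p.eval x) Filter.atTop (nhds 0) := by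
  simp_rw [Polynomial.eval_eq_sum_range, Finset.mul_sum]
  rw [show (0 : ℝ) = ∑ i ∈ Finset.range (p.natDegree + 1), p.coeff i * 0 by simp]
  apply tendsto_finsetSum
  intro i _
  have h := (tendsto_rpow_mul_exp_neg_mul_atTop_nhds_zero (s + i) 1 one_pos).const_mul (p.coeff i)
  refine h.congr' ?_
  filter_upwards [Filter.eventually_gt_atTop 0] with x hx
  rw [Real.rpow_add hx, Real.rpow_natCast]
  ring_nf

/-- The polynomial underlying `towA`. -/
noncomputable def vP (α : ℝ) (i n : ℕ) : Polynomial ℝ := Polynomial.C ((-1) ^ i) * lag (α + i) n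

lemma vP_eval (α : ℝ) (i n : ℕ) (x : ℝ) : (vP α i n).eval x = towA α n i x := by
  simp [vP, towA]

lemma vP_coeff (α : ℝ) (i n : ℕ) : (vP α i n).coeff n ≠ 0 := by
  unfold vP
  rw [Polynomial.coeff_C_mul]
  exact mul_ne_zero (by simp) (lag_top _ _)

lemma vP_coeff_gt (α : ℝ) (i n m : ℕ) (h : n < m) : (vP α i n).coeff m = 0 := by
  unfold vP
  rw [Polynomial.coeff_C_mul, Polynomial.coeff_eq_zero_of_natDegree_lt, mul_zero]
  rwa [lag_natDegree]

lemma vP_orth {α : ℝ} {k : ℕ} (ha : 0 < α + 1 + k) {m n : ℕ} (hmn : m ≠ n) :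
    ∫ x, (vP α k m).eval x * (vP α k n).eval x ∂(muL (α + 1 + k)) = 0 := by
  have h1 := integrable_poly ha (vP α k m * vP α k n)
  rw [integrable_muL] at h1
  simp only [Polynomial.eval_mul, vP_eval] at h1
  have hcm := tower_cont (towA_tower α m)
  have hcn := tower_cont (towA_tower α n)
  have := integral_Ioi_of_hasDerivAt_of_tendsto (a := (0 : ℝ)) (m := (0 : ℝ))
    (f := fun x => x ^ (α + 1 + k) * Real.exp (-x) * conc (towA α m) (towA α n) k x)
    (f' := fun x => -((n : ℝ) - m) * (wtL (α + 1 + k) x * (towA α m k x * towA α n k x)))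
    (by
      apply ContinuousAt.continuousWithinAt
      apply Continuous.continuousAt
      apply Continuous.mul
      · apply Continuous.mul
        · exact Real.continuous_rpow_const ha.le
        · fun_prop
      · unfold conc
        exact (((hcm k).mul (hcn (k+1))).sub ((hcn k).mul (hcm (k+1)))))
    (fun x hx => conc_hasDerivAt (towA_tower α m) (towA_tower α n) k hx) (h1.const_mul _)
    (by
      have := decay (α + 1 + k) (vP α k m * vP α (k + 1) n - vP α k n * vP α (k + 1) m)
      simpa only [Polynomial.eval_mul, Polynomial.eval_sub, vP_eval, conc] using this)
  rw [integral_const_mul, Real.zero_rpow ha.ne'] at this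
  simp only [vP_eval]
  rw [integral_muL]
  have hne : -((n : ℝ) - m) ≠ 0 := by
    rw [neg_ne_zero, sub_ne_zero]
    exact_mod_cast hmn.symm
  have h0 : -((n : ℝ) - m) * ∫ x in Set.Ioi 0, wtL (α + 1 + k) x * (towA α m k x * towA α n k x) = 0 := by
    rw [this]; simp
  exact (mul_eq_zero.mp h0).resolve_left hne

/-! ### Parseval -/

lemma integral_poly_zero {a : ℝ} (ha : 0 < a) (V : ℕ → Polynomial ℝ) (h1 : ∀ n, (V n).coeff n ≠ 0)
    (h2 : ∀ n m, n < m → (V n).coeff m = 0) {f : ℝ → ℝ} (hf : MemLp f 2 (muL a))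
    (h : ∀ n, ∫ x, f x * (V n).eval x ∂(muL a) = 0) (N : ℕ) :
    ∀ p : Polynomial ℝ, p.degree < (N : ℕ) → ∫ x, f x * p.eval x ∂(muL a) = 0 := by
  induction N with
  | zero =>
    intro p hp
    have : p = 0 := by
      rw [← Polynomial.degree_eq_bot]
      simpa using hp
    simp [this]
  | succ N ih =>
    intro p hp
    set t := p.coeff N / (V N).coeff N with ht
    have hq := ih (p - Polynomial.C t * V N) (by
      rw [Polynomial.degree_lt_iff_coeff_zero] at hp ⊢
      intro m hm
      rw [Polynomial.coeff_sub, Polynomial.coeff_C_mul]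
      rcases hm.eq_or_lt with rfl | hm
      · rw [ht]; field_simp [h1 N]; ring
      · rw [hp m hm, h2 N m hm]; ring)
    have e : ∀ x, f x * p.eval x =
        f x * (p - Polynomial.C t * V N).eval x + t * (f x * (V N).eval x) := by
      intro x; simp; ring
    simp_rw [e]
    rw [integral_add, hq, integral_const_mul, h N]
    · simp
    · exact hf.integrable_mul (memLp_poly ha _)
    · exact (hf.integrable_mul (memLp_poly ha _)).const_mul t

lemma complete_V {a : ℝ} (ha : 0 < a) (V : ℕ → Polynomial ℝ) (h1 : ∀ n, (V n).coeff n ≠ 0)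
    (h2 : ∀ n m, n < m → (V n).coeff m = 0) {f : ℝ → ℝ} (hf : MemLp f 2 (muL a))
    (h : ∀ n, ∫ x, f x * (V n).eval x ∂(muL a) = 0) : f =ᵐ[muL a] 0 := by
  apply complete_muL ha hf
  intro n
  have := integral_poly_zero ha V h1 h2 hf h (n + 1) (Polynomial.X ^ n) (by
    rw [Polynomial.degree_X_pow]; exact_mod_cast Nat.lt_succ_self n)
  simpa using this

lemma poly_zero_of_ae {a x1 x2 : ℝ} (h0 : 0 ≤ x1) (h12 : x1 < x2) {g : ℝ → ℝ} (hg : Continuous g)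
    (h : ∀ᵐ x ∂(muL a), x ∈ Set.Ioo x1 x2 → g x = 0) : ∀ x ∈ Set.Ioo x1 x2, g x = 0 := by
  rw [ae_muL] at h
  have h' : ∀ᵐ x ∂(volume.restrict (Set.Ioo x1 x2)), g x = 0 := by
    have := ae_restrict_of_ae_restrict_of_subset
      (show Set.Ioo x1 x2 ⊆ Set.Ioi 0 from fun x hx => lt_of_le_of_lt h0 hx.1) h
    filter_upwards [this, ae_restrict_mem measurableSet_Ioo] with x hx hx'
    exact hx hx'
  exact Measure.eqOn_open_of_ae_eq (f := g) (g := fun _ => (0 : ℝ)) h' isOpen_Ioo hg.continuousOn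
    continuousOn_const

lemma poly_norm_pos {a : ℝ} (ha : 0 < a) {p : Polynomial ℝ} (hp : p ≠ 0) :
    0 < ∫ x, p.eval x ^ 2 ∂(muL a) := by
  have hInt0 : Integrable (fun x => p.eval x ^ 2) (muL a) := by
    have h := integrable_poly ha (p ^ 2)
    simp only [Polynomial.eval_pow] at h
    exact h
  refine lt_of_le_of_ne (integral_nonneg fun x => sq_nonneg _) fun h => hp ?_
  have h' := (integral_eq_zero_iff_of_nonneg (fun x => sq_nonneg _) hInt0).mp h.symm
  have := poly_zero_of_ae (a := a) le_rfl one_pos p.continuous (by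
    filter_upwards [h'] with x hx _
    simpa using hx)
  apply Polynomial.eq_zero_of_infinite_isRoot
  exact (Set.Ioo_infinite one_pos).mono this


lemma parseval {a : ℝ} (ha : 0 < a) (V : ℕ → Polynomial ℝ) (h1 : ∀ n, (V n).coeff n ≠ 0)
    (h2 : ∀ n m, n < m → (V n).coeff m = 0)
    (h3 : ∀ m n, m ≠ n → ∫ x, (V m).eval x * (V n).eval x ∂(muL a) = 0)
    {g h : ℝ → ℝ} (hg : MemLp g 2 (muL a)) (hh : MemLp h 2 (muL a)) :
    HasSum (fun n => (∫ x, g x * (V n).eval x ∂(muL a)) * (∫ x, h x * (V n).eval x ∂(muL a)) /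
      (∫ x, (V n).eval x ^ 2 ∂(muL a))) (∫ x, g x * h x ∂(muL a)) := by
  set μ := muL a with hμ
  have hVne : ∀ n, V n ≠ 0 := fun n h => h1 n (by simp [h])
  set N : ℕ → ℝ := fun n => ∫ x, (V n).eval x ^ 2 ∂μ with hN
  have hNpos : ∀ n, 0 < N n := fun n => poly_norm_pos ha (hVne n)
  have hinner : ∀ {f₁ f₂ : ℝ → ℝ} (m₁ : MemLp f₁ 2 μ) (m₂ : MemLp f₂ 2 μ),
      inner ℝ (m₁.toLp f₁) (m₂.toLp f₂) = ∫ x, f₁ x * f₂ x ∂μ := by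
    intro f₁ f₂ m₁ m₂
    rw [L2.inner_def]
    apply integral_congr_ae
    filter_upwards [m₁.coeFn_toLp, m₂.coeFn_toLp] with x e1 e2
    rw [e1, e2]
    simp [mul_comm]
  have hV : ∀ n, MemLp (fun x => (V n).eval x) 2 μ := fun n => memLp_poly ha (V n)
  set e : ℕ → Lp ℝ 2 μ := fun n => (1 / Real.sqrt (N n)) • (hV n).toLp _ with he
  have hs : ∀ n, Real.sqrt (N n) ≠ 0 := fun n => (Real.sqrt_pos.mpr (hNpos n)).ne'
  have horth : Orthonormal ℝ e := by
    rw [orthonormal_iff_ite]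
    intro i j
    simp only [he]
    rw [real_inner_smul_left, real_inner_smul_right, hinner]
    split_ifs with hij
    · subst hij
      have : ∫ x, (V i).eval x * (V i).eval x ∂μ = Real.sqrt (N i) * Real.sqrt (N i) := by
        rw [Real.mul_self_sqrt (hNpos i).le]
        simp only [hN, sq]
      rw [this]
      field_simp [hs i]
    · rw [h3 i j hij]; simp
  have hbot : (Submodule.span ℝ (Set.range e))ᗮ = ⊥ := by
    rw [Submodule.eq_bot_iff]
    intro f hf
    have hfm := Lp.memLp f
    have h0 : ⇑f =ᵐ[μ] 0 := by
      apply complete_V ha V h1 h2 hfm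
      intro n
      have h4 := (Submodule.mem_orthogonal _ _).mp hf (e n) (Submodule.subset_span ⟨n, rfl⟩)
      have h5 : f = hfm.toLp _ := (Lp.toLp_coeFn f hfm).symm
      rw [h5] at h4
      simp only [he] at h4
      rw [real_inner_smul_left, hinner] at h4
      have h6 := (mul_eq_zero.mp h4).resolve_left (one_div_ne_zero (hs n))
      rw [← h6]
      congr 1
      funext x
      ring
    exact (Lp.eq_zero_iff_ae_eq_zero).mpr h0
  set B := HilbertBasis.mkOfOrthogonalEqBot horth hbot with hB
  have hBe : ∀ n, B n = e n := fun n => by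
    rw [hB]; simp
  have hsum := B.hasSum_inner_mul_inner (hg.toLp g) (hh.toLp h)
  rw [hinner] at hsum
  have hterm : ∀ n, inner ℝ (hg.toLp g) (B n) * inner ℝ (B n) (hh.toLp h) =
      (∫ x, g x * (V n).eval x ∂μ) * (∫ x, h x * (V n).eval x ∂μ) / N n := by
    intro n
    rw [hBe]
    simp only [he]
    rw [real_inner_smul_left, real_inner_smul_right, hinner, hinner]
    have e1 : ∫ x, (V n).eval x * h x ∂μ = ∫ x, h x * (V n).eval x ∂μ := by
      congr 1
      funext x
      ring
    have e2 : N n = Real.sqrt (N n) * Real.sqrt (N n) := (Real.mul_self_sqrt (hNpos n).le).symm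
    rw [e1]
    nth_rewrite 3 [e2]
    field_simp
  simp only [hterm] at hsum
  exact hsum

/-- tail integrals -/
noncomputable def tI (x0 : ℝ) (m : ℕ) (p : Polynomial ℝ) : ℝ :=
  ∫ x in Set.Ioi x0, (x - x0) ^ m * Real.exp (-x) * p.eval x

lemma tI_integrable (x0 : ℝ) (hx0 : 0 < x0) (m : ℕ) (p : Polynomial ℝ) :
    IntegrableOn (fun x => (x - x0) ^ m * Real.exp (-x) * p.eval x) (Set.Ioi x0) := by
  have h := integrable_poly one_pos ((Polynomial.X - Polynomial.C x0) ^ m * p)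
  rw [integrable_muL] at h
  refine (h.mono_set (Set.Ioi_subset_Ioi hx0.le)).congr_fun ?_ measurableSet_Ioi
  intro x _
  simp [wtL]
  ring

lemma vP_deriv (α : ℝ) (i n : ℕ) (x : ℝ) :
    HasDerivAt (fun x => (vP α i n).eval x) ((vP α i n).eval x + (vP α (i + 1) n).eval x) x := by
  simp only [vP_eval]
  exact (towA_tower α n).1 i x

lemma tI_zero (α : ℝ) {x0 : ℝ} (hx0 : 0 < x0) (i n : ℕ) :
    tI x0 0 (vP α (i + 1) n) = -(Real.exp (-x0) * (vP α i n).eval x0) := by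
  have h2 : ∀ x, HasDerivAt (fun x => Real.exp (-x)) (-Real.exp (-x)) x := fun x => by
    simpa using (hasDerivAt_id x).neg.exp
  have := integral_Ioi_of_hasDerivAt_of_tendsto (a := x0) (m := (0 : ℝ))
    (f := fun x => Real.exp (-x) * (vP α i n).eval x)
    (f' := fun x => (x - x0) ^ 0 * Real.exp (-x) * (vP α (i + 1) n).eval x)
    (((h2 x0).mul (vP_deriv α i n x0)).continuousAt.continuousWithinAt)
    (fun x _ => ((h2 x).mul (vP_deriv α i n x)).congr_deriv (by ring))
    (tI_integrable x0 hx0 0 _)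
    (by simpa using decay 0 (vP α i n))
  unfold tI
  rw [this]; ring

lemma tI_succ (α : ℝ) {x0 : ℝ} (hx0 : 0 < x0) (m i n : ℕ) :
    tI x0 (m + 1) (vP α (i + 1) n) = -((m + 1) * tI x0 m (vP α i n)) := by
  have h2 : ∀ x, HasDerivAt (fun x => Real.exp (-x)) (-Real.exp (-x)) x := fun x => by
    simpa using (hasDerivAt_id x).neg.exp
  have h3 : ∀ x, HasDerivAt (fun x => (x - x0) ^ (m + 1)) ((m + 1) * (x - x0) ^ m) x := fun x => by
    refine (((hasDerivAt_id x).sub_const x0).pow (m + 1)).congr_deriv ?_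
    simp
  have hd := fun x => ((h3 x).mul (h2 x)).mul (vP_deriv α i n x)
  have I1 := tI_integrable x0 hx0 (m + 1) (vP α (i + 1) n)
  have I2 := (tI_integrable x0 hx0 m (vP α i n)).const_mul ((m : ℝ) + 1)
  have := integral_Ioi_of_hasDerivAt_of_tendsto (a := x0) (m := (0 : ℝ))
    (f := fun x => (x - x0) ^ (m + 1) * Real.exp (-x) * (vP α i n).eval x)
    (f' := fun x => (x - x0) ^ (m + 1) * Real.exp (-x) * (vP α (i + 1) n).eval x
      + ((m : ℝ) + 1) * ((x - x0) ^ m * Real.exp (-x) * (vP α i n).eval x))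
    ((hd x0).continuousAt.continuousWithinAt)
    (fun x _ => (hd x).congr_deriv (by simp only [Pi.mul_apply]; ring))
    (I1.add I2)
    (by
      have := decay 0 ((Polynomial.X - Polynomial.C x0) ^ (m + 1) * vP α i n)
      simp only [Real.rpow_zero, one_mul, Polynomial.eval_mul, Polynomial.eval_pow,
        Polynomial.eval_sub, Polynomial.eval_X, Polynomial.eval_C] at this
      refine this.congr fun x => by ring)
  rw [integral_add I1 I2, integral_const_mul] at this
  unfold tI
  simp at this
  linarith

lemma tI_rep (α : ℝ) {x0 : ℝ} (hx0 : 0 < x0) (m : ℕ) :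
    ∃ C : ℝ, ∀ i n, towA α n i x0 = C * tI x0 m (vP α (i + 1 + m) n) := by
  induction m with
  | zero =>
    refine ⟨-Real.exp x0, fun i n => ?_⟩
    rw [Nat.add_zero, tI_zero α hx0, vP_eval]
    have : Real.exp x0 * Real.exp (-x0) = 1 := by rw [← Real.exp_add]; simp
    linear_combination -(towA α n i x0) * this
  | succ m ih =>
    obtain ⟨C, hC⟩ := ih
    refine ⟨-C / (m + 1), fun i n => ?_⟩
    rw [hC, ← Nat.add_assoc, tI_succ α hx0]
    field_simp

lemma q_rep {α : ℝ} {k : ℕ} (ha : 0 < α + 1 + k) {x0 : ℝ} (hx0 : 0 < x0) {j : ℕ} (hj : j < k) :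
    ∃ q : ℝ → ℝ, MemLp q 2 (muL (α + 1 + k)) ∧ (∀ x ≤ x0, q x = 0) ∧
      ∀ n, towA α n j x0 = ∫ x, q x * (vP α k n).eval x ∂(muL (α + 1 + k)) := by
  obtain ⟨m, rfl⟩ : ∃ m, k = j + 1 + m := ⟨k - (j + 1), by omega⟩
  set a := α + 1 + ((j + 1 + m : ℕ) : ℝ) with haa
  obtain ⟨C, hC⟩ := tI_rep α hx0 m
  set q0 : ℝ → ℝ := fun x => C * ((x - x0) ^ m * x ^ (1 - a)) with hq0
  refine ⟨(Set.Ioi x0).indicator q0, ?_, ?_, ?_⟩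
  · have hb := memLp_poly ha (Polynomial.C (C * x0 ^ (-a)) * Polynomial.X ^ (m + 1))
    refine hb.mono ?_ ?_
    · apply AEStronglyMeasurable.indicator _ measurableSet_Ioi
      apply Measurable.aestronglyMeasurable
      simp only [hq0]
      fun_prop
    · refine Filter.Eventually.of_forall fun x => ?_
      by_cases hx : x ∈ Set.Ioi x0
      · rw [Set.indicator_of_mem hx]
        have hx' : x0 < x := hx
        have hxp : 0 < x := hx0.trans hx'
        simp only [hq0, Polynomial.eval_mul, Polynomial.eval_C, Polynomial.eval_pow,
          Polynomial.eval_X, norm_mul, norm_pow, Real.norm_eq_abs]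
        rw [abs_of_pos (Real.rpow_pos_of_pos hxp _), abs_of_pos (Real.rpow_pos_of_pos hx0 _),
          abs_of_pos hxp, abs_of_pos (sub_pos.mpr hx'), mul_assoc]
        refine mul_le_mul_of_nonneg_left ?_ (abs_nonneg C)
        have e1 : x ^ (1 - a) = x * x ^ (-a) := by
          rw [sub_eq_add_neg, Real.rpow_add hxp, Real.rpow_one]
        have e2 : x ^ (-a) ≤ x0 ^ (-a) :=
          Real.rpow_le_rpow_of_nonpos hx0 hx'.le (by linarith)
        have e3 : (x - x0) ^ m ≤ x ^ m :=
          pow_le_pow_left₀ (sub_nonneg.mpr hx'.le) (by linarith) m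
        rw [e1]
        calc (x - x0) ^ m * (x * x ^ (-a)) ≤ x ^ m * (x * x0 ^ (-a)) := by gcongr
          _ = _ := by ring
      · rw [Set.indicator_of_notMem hx, norm_zero]; exact norm_nonneg _
  · intro x hx
    apply Set.indicator_of_notMem
    simpa using hx
  · intro n
    rw [hC, integral_muL, tI, ← integral_const_mul]
    have : (fun x => wtL a x * ((Set.Ioi x0).indicator q0 x * (vP α (j + 1 + m) n).eval x)) =
      (Set.Ioi x0).indicator (fun x => wtL a x * (q0 x * (vP α (j + 1 + m) n).eval x)) := by
      funext x
      by_cases hx : x ∈ Set.Ioi x0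
      · simp [Set.indicator_of_mem hx]
      · simp [Set.indicator_of_notMem hx]
    rw [this, setIntegral_indicator measurableSet_Ioi, Set.inter_eq_right.mpr (Set.Ioi_subset_Ioi hx0.le)]
    apply setIntegral_congr_fun measurableSet_Ioi
    intro x hx
    have hxp : 0 < x := hx0.trans hx
    have : x ^ (a - 1) * x ^ (1 - a) = 1 := by
      rw [← Real.rpow_add hxp]; simp
    simp only [wtL, hq0]
    linear_combination -(C * (x - x0) ^ m * Real.exp (-x) * (vP α (j + 1 + m) n).eval x) * this


/-! ### The core argument -/

lemma sp_hasSum {α : ℝ} {k : ℕ} (ha : 0 < α + 1 + k) {x0 : ℝ} (hx0 : 0 < x0) {z : ℝ → ℝ}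
    (hz : MemLp z 2 (muL (α + 1 + k))) (hz0 : ∀ x, x0 < x → z x = 0) (r : ℕ → ℝ)
    (hr : r ∈ Sp (towA α) x0 k) :
    HasSum (fun n => r n * (∫ x, z x * (vP α k n).eval x ∂(muL (α + 1 + k))) /
      (∫ x, (vP α k n).eval x ^ 2 ∂(muL (α + 1 + k)))) 0 := by
  unfold Sp at hr
  induction hr using Submodule.span_induction with
  | mem r hr =>
    obtain ⟨j, hj, rfl⟩ := hr
    obtain ⟨q, hq, hq0, hq1⟩ := q_rep ha hx0 hj
    have := parseval ha (vP α k) (vP_coeff α k) (fun n m h => vP_coeff_gt α k n m h)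
      (fun m n h => vP_orth ha h) hq hz
    simp only [← hq1] at this
    have e : ∫ x, q x * z x ∂(muL (α + 1 + k)) = 0 := by
      rw [← integral_zero ℝ ℝ (μ := muL (α + 1 + k))]
      congr 1
      funext x
      rcases le_or_gt x x0 with h | h
      · rw [hq0 x h, zero_mul]
      · rw [hz0 x h, mul_zero]
    rw [e] at this
    exact this
  | zero => simp
  | add r s _ _ h1 h2 =>
    have h3 := h1.add h2
    rw [add_zero] at h3
    have e : ∀ n, (r + s) n * (∫ x, z x * (vP α k n).eval x ∂(muL (α + 1 + k))) /
        (∫ x, (vP α k n).eval x ^ 2 ∂(muL (α + 1 + k))) =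
        r n * (∫ x, z x * (vP α k n).eval x ∂(muL (α + 1 + k))) /
        (∫ x, (vP α k n).eval x ^ 2 ∂(muL (α + 1 + k))) +
        s n * (∫ x, z x * (vP α k n).eval x ∂(muL (α + 1 + k))) /
        (∫ x, (vP α k n).eval x ^ 2 ∂(muL (α + 1 + k))) := by
      intro n
      rw [Pi.add_apply]
      ring
    simp only [e]
    exact h3
  | smul t r _ h1 =>
    have h3 := h1.mul_left t
    rw [mul_zero] at h3
    have e : ∀ n, (t • r) n * (∫ x, z x * (vP α k n).eval x ∂(muL (α + 1 + k))) /
        (∫ x, (vP α k n).eval x ^ 2 ∂(muL (α + 1 + k))) =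
        t * (r n * (∫ x, z x * (vP α k n).eval x ∂(muL (α + 1 + k))) /
        (∫ x, (vP α k n).eval x ^ 2 ∂(muL (α + 1 + k)))) := by
      intro n
      rw [Pi.smul_apply, smul_eq_mul]
      ring
    simp only [e]
    exact h3

lemma core {α : ℝ} {k : ℕ} (ha : 0 < α + 1 + k) {x0 : ℝ} (hx0 : 0 < x0) {lam : Fin k → ℝ}
    {φ : Fin k → ℕ → ℝ → ℝ} (hφ : ∀ f, IsTower (α + 1) (lam f) (φ f)) {b : Fin k → ℝ}
    (H : ∀ i < k, ∑ f, b f * φ f i x0 = 0)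
    (hQ : ∀ n : ℕ, ∏ j ∈ Finset.range k, ((n : ℝ) + (α + 1) + j) ≠ 0)
    (hadm : ∀ n : ℕ, 0 ≤ (∏ f, ((n : ℝ) - lam f)) / ∏ j ∈ Finset.range k, ((n : ℝ) + (α + 1) + j)) :
    ∀ x ∈ Set.Ioo 0 x0, ∑ f, b f * φ f k x = 0 := by
  set a := α + 1 + (k : ℝ) with haa
  set G : ℝ → ℝ := fun x => ∑ f, b f * φ f k x with hG
  have hGc : Continuous G := by
    apply continuous_finsetSum
    intro f _
    exact continuous_const.mul (tower_cont (hφ f) k)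
  have hfact : Fact (0 < a) := ⟨ha⟩
  set z : ℝ → ℝ := (Set.Ioc 0 x0).indicator G with hz
  have hzm : MemLp z 2 (muL a) := by
    obtain ⟨M, hM⟩ := isCompact_Icc.exists_bound_of_continuousOn (s := Set.Icc 0 x0) hGc.continuousOn
    refine MemLp.of_bound ((hGc.aestronglyMeasurable).indicator measurableSet_Ioc) (max M 0) ?_
    refine Filter.Eventually.of_forall fun x => ?_
    by_cases hx : x ∈ Set.Ioc 0 x0
    · rw [hz, Set.indicator_of_mem hx]
      exact (hM x ⟨hx.1.le, hx.2⟩).trans (le_max_left _ _)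
    · rw [hz, Set.indicator_of_notMem hx, norm_zero]
      exact le_max_right _ _
  have hz0 : ∀ x, x0 < x → z x = 0 := by
    intro x hx
    apply Set.indicator_of_notMem
    intro h
    exact absurd h.2 (not_le.mpr hx)
  set zn : ℕ → ℝ := fun n => ∫ x, z x * (vP α k n).eval x ∂(muL a) with hzn
  set N : ℕ → ℝ := fun n => ∫ x, (vP α k n).eval x ^ 2 ∂(muL a) with hN
  have hNpos : ∀ n, 0 < N n := fun n =>
    poly_norm_pos ha (fun h => vP_coeff α k n (by simp [h]))
  have hzn1 : ∀ n : ℕ, (∏ f, ((n : ℝ) - lam f)) * zn n =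
      -(x0 ^ a * Real.exp (-x0)) * DD lam φ b (towA α) x0 k n := by
    intro n
    have e1 : zn n = ∑ f, b f * ∫ x in (0 : ℝ)..x0, wtL a x * (φ f k x * towA α n k x) := by
      simp only [hzn, hz]
      rw [integral_trunc hx0]
      simp only [vP_eval, hG]
      rw [show (fun x => wtL a x * ((∑ f, b f * φ f k x) * towA α n k x)) =
        fun x => ∑ f, b f * (wtL a x * (φ f k x * towA α n k x)) by
          funext x
          rw [Finset.sum_mul, Finset.mul_sum]
          exact Finset.sum_congr rfl fun f _ => by ring]
      rw [intervalIntegral.integral_finsetSum]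
      · simp only [intervalIntegral.integral_const_mul]
      · intro f _
        exact (wtL_intervalIntegrable ha
          ((tower_cont (hφ f) k).mul (tower_cont (towA_tower α n) k))).const_mul _
    rw [e1, DD, Finset.mul_sum, Finset.mul_sum]
    apply Finset.sum_congr rfl
    intro f _
    have h := green (hφ f) (towA_tower α n) k ha hx0
    rw [← Finset.mul_prod_erase Finset.univ (fun f' => (n : ℝ) - lam f') (Finset.mem_univ f)]
    linear_combination b f * (∏ f' ∈ Finset.univ.erase f, ((n : ℝ) - lam f')) * h
  have hsum := sp_hasSum ha hx0 hzm hz0 _ (DD_mem hφ (towA_tower α) H)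
  set R : ℕ → ℝ := fun n =>
    (∏ f, ((n : ℝ) - lam f)) / (∏ j ∈ Finset.range k, ((n : ℝ) + (α + 1) + j)) with hR
  have hRz : ∀ n, R n * zn n = -(x0 ^ a * Real.exp (-x0)) / x0 ^ k * DD lam φ b (towA α) x0 0 n := by
    intro n
    have h1 := DD_step hφ (towA_tower α) H n k le_rfl
    have h2 := hzn1 n
    have h3 := hQ n
    simp only [hR]
    have h4 : x0 ^ k ≠ 0 := by positivity
    rw [div_mul_eq_mul_div, div_mul_eq_mul_div, div_eq_div_iff h3 h4]
    linear_combination x0 ^ k * h2 - (x0 ^ a * Real.exp (-x0)) * h1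
  have hsum2 : HasSum (fun n => R n * zn n ^ 2 / N n) 0 := by
    have := hsum.mul_left (-(x0 ^ a * Real.exp (-x0)) / x0 ^ k)
    rw [mul_zero] at this
    have e : ∀ n, R n * zn n ^ 2 / N n = -(x0 ^ a * Real.exp (-x0)) / x0 ^ k *
        (DD lam φ b (towA α) x0 0 n * zn n / N n) := by
      intro n
      rw [sq, ← mul_assoc (R n), hRz n]
      ring
    simp only [e]
    exact this
  have hterm := (hasSum_zero_iff_of_nonneg (fun n => by
    have := hNpos n
    have := hadm n
    positivity)).mp hsum2
  obtain ⟨M, hM⟩ : ∃ M : ℕ, ∀ n ≥ M, zn n = 0 := by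
    obtain ⟨M, hM⟩ := exists_nat_gt (∑ f, |lam f|)
    refine ⟨M, fun n hn => ?_⟩
    have h := congrFun hterm n
    simp only [Pi.zero_apply] at h
    have hP : (∏ f, ((n : ℝ) - lam f)) ≠ 0 := by
      rw [Finset.prod_ne_zero_iff]
      intro f _
      have h1 : |lam f| ≤ ∑ f, |lam f| :=
        Finset.single_le_sum (f := fun f => |lam f|) (fun i _ => abs_nonneg _) (Finset.mem_univ f)
      have h2 : (M : ℝ) ≤ n := by exact_mod_cast hn
      have h3 := le_abs_self (lam f)
      have : 0 < (n : ℝ) - lam f := by linarith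
      exact this.ne'
    have hRn : R n ≠ 0 := div_ne_zero hP (hQ n)
    rw [div_eq_zero_iff] at h
    rcases h with h | h
    · rcases mul_eq_zero.mp h with h | h
      · exact absurd h hRn
      · exact pow_eq_zero_iff (two_ne_zero) |>.mp h
    · exact absurd h (hNpos n).ne'
  set S : Polynomial ℝ := ∑ n ∈ Finset.range M, Polynomial.C (zn n / N n) * vP α k n with hS
  have hae : (fun x => z x - S.eval x) =ᵐ[muL a] 0 := by
    apply complete_V ha (vP α k) (vP_coeff α k) (fun n m h => vP_coeff_gt α k n m h)
      (hzm.sub (memLp_poly ha S))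
    intro m
    simp only [Pi.sub_apply, sub_mul]
    have i1 : Integrable (fun x => z x * (vP α k m).eval x) (muL a) :=
      hzm.integrable_mul (memLp_poly ha _)
    have i2 : Integrable (fun x => S.eval x * (vP α k m).eval x) (muL a) :=
      (memLp_poly ha S).integrable_mul (memLp_poly ha _)
    rw [integral_sub i1 i2]
    have e : ∫ x, S.eval x * (vP α k m).eval x ∂(muL a) =
        ∑ n ∈ Finset.range M, zn n / N n * ∫ x, (vP α k n).eval x * (vP α k m).eval x ∂(muL a) := by
      simp only [hS, Polynomial.eval_finsetSum, Polynomial.eval_mul, Polynomial.eval_C,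
        Finset.sum_mul, mul_assoc]
      rw [integral_finsetSum]
      · simp only [integral_const_mul]
      · intro n _
        exact ((memLp_poly ha _).integrable_mul (memLp_poly ha _)).const_mul _
    have e2 : ∑ n ∈ Finset.range M, zn n / N n *
        ∫ x, (vP α k n).eval x * (vP α k m).eval x ∂(muL a) = zn m := by
      rw [Finset.sum_eq_single m]
      · have : ∫ x, (vP α k m).eval x * (vP α k m).eval x ∂(muL a) = N m := by
          simp only [hN, sq]
        rw [this, div_mul_cancel₀ _ (hNpos m).ne']
      · intro n _ hn
        rw [vP_orth ha hn, mul_zero]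
      · intro hm
        rw [hM m (by simpa using hm)]; simp
    rw [e, e2]
    exact sub_self _
  have hS0 : S = 0 := by
    have := poly_zero_of_ae (a := a) hx0.le (lt_add_one x0) S.continuous (by
      filter_upwards [hae] with x hx hx'
      rw [hz0 x hx'.1] at hx
      simpa using hx)
    apply Polynomial.eq_zero_of_infinite_isRoot
    exact (Set.Ioo_infinite (lt_add_one x0)).mono this
  apply poly_zero_of_ae (a := a) le_rfl hx0 hGc
  filter_upwards [hae] with x hx hx'
  rw [hS0, hz, Set.indicator_of_mem (show x ∈ Set.Ioc 0 x0 from ⟨hx'.1, hx'.2.le⟩)] at hx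
  simpa using hx


/-! ### Conclusion of the analytic part -/

lemma jets_all {k : ℕ} {c x0 : ℝ} (hx0 : 0 < x0) {lam : Fin k → ℝ} {φ : Fin k → ℕ → ℝ → ℝ}
    (hφ : ∀ f, IsTower c (lam f) (φ f)) {b : Fin k → ℝ}
    (H : ∀ i < k, ∑ f, b f * φ f i x0 = 0)
    (hG : ∀ x ∈ Set.Ioo 0 x0, ∑ f, b f * φ f k x = 0) (i : ℕ) : ∑ f, b f * φ f i x0 = 0 := by
  have hd : ∀ i x, HasDerivAt (fun x => ∑ f, b f * φ f i x)
      (∑ f, b f * φ f i x + ∑ f, b f * φ f (i + 1) x) x := by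
    intro i x
    have := HasDerivAt.fun_sum (u := Finset.univ) (fun f _ => ((hφ f).1 i x).const_mul (b f))
    refine this.congr_deriv ?_
    rw [← Finset.sum_add_distrib]
    exact Finset.sum_congr rfl fun f _ => by ring
  have hI : ∀ m, ∀ x ∈ Set.Ioo 0 x0, ∑ f, b f * φ f (k + m) x = 0 := by
    intro m
    induction m with
    | zero => exact hG
    | succ m ih =>
      intro x hx
      have h1 := hd (k + m) x
      have h2 : (fun x => ∑ f, b f * φ f (k + m) x) =ᶠ[nhds x] fun _ => (0 : ℝ) := by
        filter_upwards [isOpen_Ioo.mem_nhds hx] with y hy using ih y hy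
      have h3 := (h1.congr_of_eventuallyEq h2.symm).unique (hasDerivAt_const x (0 : ℝ))
      rw [ih x hx, zero_add] at h3
      exact h3
  by_cases hi : i < k
  · exact H i hi
  · obtain ⟨m, rfl⟩ : ∃ m, i = k + m := ⟨i - k, by omega⟩
    have hc : Continuous (fun x => ∑ f, b f * φ f (k + m) x) :=
      continuous_iff_continuousAt.mpr fun x => (hd (k + m) x).continuousAt
    have h1 : Set.EqOn (fun x => ∑ f, b f * φ f (k + m) x) (fun _ => (0 : ℝ))
        (closure (Set.Ioo 0 x0)) :=
      Set.EqOn.closure (fun x hx => hI m x hx) hc continuous_const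
    rw [closure_Ioo hx0.ne] at h1
    exact h1 ⟨hx0.le, le_rfl⟩

lemma all_zero {k : ℕ} {c x0 : ℝ} {lam : Fin k → ℝ} {φ : Fin k → ℕ → ℝ → ℝ}
    (hφ : ∀ f, IsTower c (lam f) (φ f)) (hinj : Function.Injective lam) {b : Fin k → ℝ}
    (H : ∀ i, ∑ f, b f * φ f i x0 = 0) (f : Fin k) (i : ℕ) : b f * φ f i x0 = 0 := by
  have := Matrix.eq_zero_of_forall_pow_sum_mul_pow_eq_zero (f := lam)
    (v := fun f => b f * φ f i x0) hinj (fun a => by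
      have := jets_pow hφ (i + 2 * a + 1) (fun i _ => H i) a i (by omega)
      rw [← this]
      exact Finset.sum_congr rfl fun f _ => by ring)
  exact congrFun this f

lemma all_zero_zero {k : ℕ} {c : ℝ} {lam : Fin k → ℝ} {φ : Fin k → ℕ → ℝ → ℝ}
    (hφ : ∀ f, IsTower c (lam f) (φ f)) (hinj : Function.Injective lam) {b : Fin k → ℝ}
    (H : ∀ i < k, ∑ f, b f * φ f i 0 = 0) (f : Fin k) : b f * φ f 0 0 = 0 := by
  have := Matrix.eq_zero_of_forall_pow_sum_mul_pow_eq_zero (f := lam)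
    (v := fun f => b f * φ f 0 0) hinj (fun a => by
      have := jets_pow_zero hφ k H a 0 (by simp)
      refine Eq.trans ?_ this
      exact Finset.sum_congr rfl fun f _ => by ring)
  exact congrFun this f

lemma lag_eval_zero_ne {α : ℝ} (hα : ∀ n : ℕ, α ≠ -((n : ℝ) + 1)) (f : ℕ) :
    (lag α f).eval 0 ≠ 0 := by
  rw [← Polynomial.coeff_zero_eq_eval_zero, lag_coeff, if_pos (Nat.zero_le f)]
  simp only [pow_zero, Nat.factorial_zero, Nat.cast_one, div_one, one_mul, Nat.sub_zero, gbinom]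
  apply div_ne_zero
  · rw [Finset.prod_ne_zero_iff]
    intro i hi h
    have hi' := Finset.mem_range.mp hi
    apply hα (f - i - 1)
    have : ((f - i - 1 : ℕ) : ℝ) = f - i - 1 := by
      rw [Nat.cast_sub (by omega), Nat.cast_sub (by omega)]; simp
    rw [this]
    linarith
  · positivity

lemma towA_zero_ne {α : ℝ} (hα : ∀ n : ℕ, α ≠ -((n : ℝ) + 1)) (f : ℕ) : towA α f 0 0 ≠ 0 := by
  simpa [towA] using lag_eval_zero_ne hα f

lemma towB_zero_ne {α : ℝ} (hα : ∀ n : ℕ, α ≠ -((n : ℝ) + 1)) (f : ℕ) : towB α f 0 0 ≠ 0 := by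
  simpa [towB, iterDeriv_zero] using lag_eval_zero_ne hα f

/-- Two parameter arrays joining the rows of the determinant to the towers. -/
noncomputable def rhoA (α : ℝ) (f s j : ℕ) (x : ℝ) : ℝ :=
  (-1) ^ s * (iterDeriv j (lag (α + s) f)).eval x

noncomputable def rhoB (α : ℝ) (f s j : ℕ) (x : ℝ) : ℝ :=
  (iterDeriv s ((lag (α + j) f).comp (-Polynomial.X))).eval x

lemma rhoA_step (α : ℝ) (f s j : ℕ) (x : ℝ) :
    rhoA α f (s + 1) j x = rhoA α f s (j + 1) x - rhoA α f s j x := by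
  unfold rhoA
  rw [iterDeriv_succ', lag_derivative, iterDeriv_sub, Polynomial.eval_sub]
  push_cast
  rw [add_assoc, pow_succ]
  ring

lemma rhoB_step (α : ℝ) (f s j : ℕ) (x : ℝ) :
    rhoB α f (s + 1) j x = rhoB α f s (j + 1) x - rhoB α f s j x := by
  unfold rhoB
  rw [iterDeriv_succ', lagneg_derivative, iterDeriv_sub, Polynomial.eval_sub]
  push_cast
  rw [add_assoc]

lemma rhoA_zero (α : ℝ) (f s : ℕ) (x : ℝ) : rhoA α f s 0 x = towA α f s x := by
  simp [rhoA, towA, iterDeriv_zero]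

lemma rhoB_zero (α : ℝ) (f s : ℕ) (x : ℝ) : Real.exp x * rhoB α f s 0 x = towB α f s x := by
  simp [rhoB, towB]

lemma towA_exists_ne (α : ℝ) (f : ℕ) (x : ℝ) : ∃ i, towA α f i x ≠ 0 := by
  by_contra! h
  have h1 : ∀ j s, rhoA α f s j x = 0 := by
    intro j
    induction j with
    | zero => intro s; rw [rhoA_zero, h]
    | succ j ih =>
      intro s
      have := rhoA_step α f s j x
      rw [ih, ih] at this
      linarith
  have h2 := h1 f 0
  have h3 := iterDeriv_top (lag α f) x (fun h => lag_top α f (by simp [h]))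
  rw [lag_natDegree] at h3
  apply h3
  simpa [rhoA] using h2

lemma towB_exists_ne (α : ℝ) (f : ℕ) (x : ℝ) : ∃ i, towB α f i x ≠ 0 := by
  have hne : (lag α f).comp (-Polynomial.X) ≠ 0 := by
    intro h
    have h2 := congrArg (fun p : Polynomial ℝ => p.comp (-Polynomial.X)) h
    simp only [Polynomial.comp_assoc, Polynomial.neg_comp, Polynomial.X_comp, neg_neg,
      Polynomial.comp_X, Polynomial.zero_comp] at h2
    exact lag_top α f (by simp [h2])
  exact ⟨_, mul_ne_zero (Real.exp_ne_zero _) (iterDeriv_top _ x hne)⟩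

/-! ### Admissibility -/

noncomputable def admP (c : ℝ) (F1 F2 : Finset ℕ) : Polynomial ℝ :=
  (∏ f ∈ F1, (Polynomial.X - Polynomial.C (f : ℝ))) *
    ∏ f ∈ F2, (Polynomial.X - Polynomial.C (-(c + f)))

lemma admP_eval (c : ℝ) (F1 F2 : Finset ℕ) (x : ℝ) : (admP c F1 F2).eval x =
    (∏ f ∈ F1, (x - f)) * ∏ f ∈ F2, (x + c + f) := by
  simp only [admP, Polynomial.eval_mul, Polynomial.eval_prod, Polynomial.eval_sub,
    Polynomial.eval_X, Polynomial.eval_C]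
  congr 1
  exact Finset.prod_congr rfl fun f _ => by ring

lemma admP_monic (c : ℝ) (F1 F2 : Finset ℕ) : (admP c F1 F2).Monic :=
  (Polynomial.monic_prod_of_monic _ _ fun _ _ => Polynomial.monic_X_sub_C _).mul
    (Polynomial.monic_prod_of_monic _ _ fun _ _ => Polynomial.monic_X_sub_C _)

lemma admP_natDegree (c : ℝ) (F1 F2 : Finset ℕ) :
    (admP c F1 F2).natDegree = F1.card + F2.card := by
  unfold admP
  rw [Polynomial.Monic.natDegree_mul
    (Polynomial.monic_prod_of_monic _ _ fun _ _ => Polynomial.monic_X_sub_C _)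
    (Polynomial.monic_prod_of_monic _ _ fun _ _ => Polynomial.monic_X_sub_C _),
    Polynomial.natDegree_prod_of_monic _ _ (fun i _ => Polynomial.monic_X_sub_C _),
    Polynomial.natDegree_prod_of_monic _ _ (fun i _ => Polynomial.monic_X_sub_C _)]
  simp only [Polynomial.natDegree_X_sub_C, Finset.sum_const, smul_eq_mul, mul_one]

lemma chat_pos {c : ℝ} (hc : ∀ n : ℕ, c ≠ -(n : ℝ)) : 0 < c + chat c := by
  have h1 := Int.floor_le c
  have h2 : (-⌊c⌋ : ℤ) ≤ (chat c : ℤ) := Int.self_le_toNat _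
  have h3 : (-(⌊c⌋ : ℝ)) ≤ (chat c : ℝ) := by exact_mod_cast h2
  have h4 := hc (chat c)
  refine lt_of_le_of_ne (by linarith) fun h => h4 (by linarith)

lemma chat_le {c : ℝ} (hc : ∀ n : ℕ, c ≠ -(n : ℝ)) {F1 F2 : Finset ℕ}
    (hadm : IsAdmissible c F1 F2) : chat c ≤ F1.card + F2.card := by
  by_contra! hlt
  set N := chat c with hN
  have hNpos : 0 < N := by omega
  have hfl : (N : ℤ) = -⌊c⌋ := by
    rw [hN, chat] at hNpos ⊢
    omega
  have hub : c < -(N : ℝ) + 1 := by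
    have h1 := Int.lt_floor_add_one c
    have h2 : (N : ℝ) = -(⌊c⌋ : ℝ) := by exact_mod_cast hfl
    linarith
  have hlb := chat_pos hc
  rw [← hN] at hlb
  have hsign : ∀ n ≤ N, 0 < (-1 : ℝ) ^ (N - n) * poch ((n : ℝ) + c) N := by
    intro n hn
    obtain ⟨m, hm⟩ : ∃ m, N = m + n := ⟨N - n, by omega⟩
    clear_value N
    subst hm
    rw [Nat.add_sub_cancel, poch, Finset.prod_range_add, ← mul_assoc]
    push_cast at hub hlb
    apply mul_pos
    · have : (-1 : ℝ) ^ m * ∏ i ∈ Finset.range m, ((n : ℝ) + c + i) =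
          ∏ i ∈ Finset.range m, (-((n : ℝ) + c + i)) := by
        rw [Finset.prod_neg]; simp
      rw [this]
      apply Finset.prod_pos
      intro i hi
      have hi' : (i : ℝ) + 1 ≤ m := by exact_mod_cast Finset.mem_range.mp hi
      linarith
    · apply Finset.prod_pos
      intro i _
      push_cast
      have : (0 : ℝ) ≤ i := Nat.cast_nonneg i
      linarith
  set P := admP c F1 F2 with hP
  have hP0 : ∀ n ≤ N, 0 ≤ (-1 : ℝ) ^ (N - n) * P.eval (n : ℝ) := by
    intro n hn
    have h1 := hadm n
    have h2 := hsign n hn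
    rw [← admP_eval, ← hP, ← hN] at h1
    have h3 : poch ((n : ℝ) + c) N ≠ 0 := fun h => by simp [h] at h2
    have h4 := mul_nonneg h1 h2.le
    have h5 : P.eval (n : ℝ) / poch ((n : ℝ) + c) N * ((-1) ^ (N - n) * poch ((n : ℝ) + c) N) =
      (-1 : ℝ) ^ (N - n) * P.eval (n : ℝ) := by field_simp
    rwa [h5] at h4
  have hdiff := congrFun (Polynomial.fwdDiff_iter_eq_zero_of_degree_lt (P := P) (n := N)
    (by rw [hP, admP_natDegree]; exact hlt)) 0
  rw [fwdDiff_iter_eq_sum_shift] at hdiff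
  have hdiff2 : ∑ n ∈ Finset.range (N + 1), (N.choose n : ℝ) * ((-1 : ℝ) ^ (N - n) * P.eval (n : ℝ))
      = 0 := by
    rw [show (0 : ℝ) = (0 : ℝ → ℝ) 0 from rfl, ← hdiff]
    apply Finset.sum_congr rfl
    intro n _
    simp
    ring
  rw [Finset.sum_eq_zero_iff_of_nonneg (fun n hn => mul_nonneg (Nat.cast_nonneg _)
    (hP0 n (by have := Finset.mem_range.mp hn; omega)))] at hdiff2
  have hroot : ∀ n ∈ Finset.range (N + 1), P.eval (n : ℝ) = 0 := by
    intro n hn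
    have h1 := hdiff2 n hn
    have h2 : (N.choose n : ℝ) ≠ 0 := by
      have := Nat.choose_pos (show n ≤ N by have := Finset.mem_range.mp hn; omega)
      exact_mod_cast this.ne'
    have h3 : (-1 : ℝ) ^ (N - n) ≠ 0 := by simp
    exact (mul_eq_zero.mp ((mul_eq_zero.mp h1).resolve_left h2)).resolve_left h3
  have : P = 0 := by
    apply Polynomial.eq_zero_of_natDegree_lt_card_of_eval_eq_zero P
      (f := fun n : Fin (N + 1) => ((n : ℕ) : ℝ))
    · intro a b hab
      exact Fin.ext (Nat.cast_injective hab)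
    · intro n
      exact hroot n (Finset.mem_range.mpr n.2)
    · rw [hP, admP_natDegree, Fintype.card_fin]; omega
  exact (admP_monic c F1 F2).ne_zero this

lemma adm_ratio {c : ℝ} (hc : ∀ n : ℕ, c ≠ -(n : ℝ)) {F1 F2 : Finset ℕ}
    (hadm : IsAdmissible c F1 F2) (n : ℕ) :
    0 ≤ (admP c F1 F2).eval (n : ℝ) /
      ∏ j ∈ Finset.range (F1.card + F2.card), ((n : ℝ) + c + j) := by
  obtain ⟨m, hm⟩ := Nat.exists_eq_add_of_le (chat_le hc hadm)
  rw [hm, Finset.prod_range_add, ← div_div]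
  apply div_nonneg
  · rw [admP_eval]
    exact hadm n
  · apply Finset.prod_nonneg
    intro i _
    have := chat_pos hc
    have h1 : (0 : ℝ) ≤ n := Nat.cast_nonneg n
    have h2 : (0 : ℝ) ≤ i := Nat.cast_nonneg i
    push_cast
    linarith

/-! ### Bookkeeping -/

lemma nth_eq (F : Finset ℕ) (i : Fin F.card) : nth F i = F.orderEmbOfFin rfl i := by
  rw [Finset.orderEmbOfFin_apply, nth]
  simp

lemma nth_inj (F : Finset ℕ) {i j : ℕ} (hi : i < F.card) (hj : j < F.card)
    (h : nth F i = nth F j) : i = j := by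
  have h1 := nth_eq F ⟨i, hi⟩
  have h2 := nth_eq F ⟨j, hj⟩
  simp only at h1 h2
  rw [h1, h2] at h
  simpa using h

lemma prod_nth (F : Finset ℕ) (g : ℕ → ℝ) : ∏ i : Fin F.card, g (nth F i) = ∏ f ∈ F, g f := by
  simp only [nth_eq]
  conv_rhs => rw [← Finset.map_orderEmbOfFin_univ F rfl]
  rw [Finset.prod_map]
  rfl

noncomputable def phiF (α : ℝ) (F1 F2 : Finset ℕ) (i : Fin (F1.card + F2.card)) : ℕ → ℝ → ℝ :=
  if (i : ℕ) < F1.card then towA α (nth F1 i) else towB α (nth F2 ((i : ℕ) - F1.card))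

noncomputable def lamF (α : ℝ) (F1 F2 : Finset ℕ) (i : Fin (F1.card + F2.card)) : ℝ :=
  if (i : ℕ) < F1.card then (nth F1 i : ℝ) else -(α + 1 + nth F2 ((i : ℕ) - F1.card))

lemma phiF_tower (α : ℝ) (F1 F2 : Finset ℕ) (i : Fin (F1.card + F2.card)) :
    IsTower (α + 1) (lamF α F1 F2 i) (phiF α F1 F2 i) := by
  unfold phiF lamF
  split_ifs
  · exact towA_tower α _
  · exact towB_tower α _

lemma lamF_inj {α : ℝ} (hα : ∀ n : ℕ, α ≠ -((n : ℝ) + 1)) (F1 F2 : Finset ℕ) :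
    Function.Injective (lamF α F1 F2) := by
  intro i j h
  unfold lamF at h
  have hi := i.2
  have hj := j.2
  split_ifs at h with h1 h2 h2
  · exact Fin.ext (nth_inj F1 h1 h2 (by exact_mod_cast h))
  · exact absurd (by push_cast; linarith) (hα (nth F1 i + nth F2 (j - F1.card)))
  · exact absurd (by push_cast; linarith) (hα (nth F1 j + nth F2 (i - F1.card)))
  · have h3 : nth F2 (i - F1.card) = nth F2 (j - F1.card) := by
      have : (nth F2 (i - F1.card) : ℝ) = nth F2 (j - F1.card) := by linarith
      exact_mod_cast this
    have := nth_inj F2 (by omega) (by omega) h3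
    exact Fin.ext (by omega)

lemma lamF_prod (α : ℝ) (F1 F2 : Finset ℕ) (x : ℝ) :
    ∏ i, (x - lamF α F1 F2 i) = (admP (α + 1) F1 F2).eval x := by
  rw [Fin.prod_univ_add, admP_eval]
  congr 1
  · rw [← prod_nth F1 (fun f => x - f)]
    apply Finset.prod_congr rfl
    intro i _
    simp [lamF]
  · rw [← prod_nth F2 (fun f => x + (α + 1) + f)]
    apply Finset.prod_congr rfl
    intro i _
    simp [lamF]
    ring

lemma rows_jets {α x : ℝ} {F1 F2 : Finset ℕ} (h : (OmegaL α F1 F2).eval x = 0) :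
    ∃ b : Fin (F1.card + F2.card) → ℝ, b ≠ 0 ∧
      ∀ i < F1.card + F2.card, ∑ f, b f * phiF α F1 F2 f i x = 0 := by
  set ρ : Fin (F1.card + F2.card) → ℕ → ℕ → ℝ := fun i s j =>
    if (i : ℕ) < F1.card then rhoA α (nth F1 i) s j x
    else rhoB α (nth F2 ((i : ℕ) - F1.card)) s j x with hρ
  have hstep : ∀ i s j, ρ i (s + 1) j = ρ i s (j + 1) - ρ i s j := by
    intro i s j
    simp only [hρ]
    split_ifs
    · exact rhoA_step _ _ _ _ _
    · exact rhoB_step _ _ _ _ _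
  have hdet : (Matrix.of fun i j : Fin (F1.card + F2.card) => ρ i 0 j).det = 0 := by
    rw [← h, OmegaL, ← Polynomial.coe_evalRingHom, RingHom.map_det]
    congr 1
    ext i j
    simp only [RingHom.mapMatrix_apply, Matrix.map_apply, Matrix.of_apply, hρ,
      Polynomial.coe_evalRingHom]
    split_ifs
    · simp [rhoA]
    · simp [rhoB, iterDeriv_zero]
  obtain ⟨u, hu, hu0⟩ := Matrix.exists_vecMul_eq_zero_iff.mpr hdet
  have hall : ∀ s j, s + j < F1.card + F2.card → ∑ i, u i * ρ i s j = 0 := by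
    intro s
    induction s with
    | zero =>
      intro j hj
      have := congrFun hu0 ⟨j, by omega⟩
      simpa [Matrix.vecMul, dotProduct] using this
    | succ s ih =>
      intro j hj
      simp only [hstep, mul_sub, Finset.sum_sub_distrib]
      rw [ih _ (by omega), ih _ (by omega), sub_zero]
  refine ⟨fun i => if (i : ℕ) < F1.card then u i else u i * Real.exp (-x), ?_, ?_⟩
  · intro h0
    apply hu
    funext i
    have := congrFun h0 i
    simp only [Pi.zero_apply] at this
    split_ifs at this
    · exact this
    · exact (mul_eq_zero.mp this).resolve_right (Real.exp_ne_zero _)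
  · intro s hs
    rw [← hall s 0 (by omega)]
    apply Finset.sum_congr rfl
    intro i _
    simp only [hρ, phiF]
    split_ifs
    · rw [rhoA_zero]
    · rw [← rhoB_zero]
      have : Real.exp (-x) * Real.exp x = 1 := by rw [← Real.exp_add]; simp
      linear_combination u i * rhoB α (nth F2 (i - F1.card)) s 0 x * this


/-- Lemma 6.2: if `α + 1` and `𝓕` are admissible then `α + k > -1` and `Ω_𝓕^α` does not
vanish on `[0, +∞)`. -/
theorem omegaL_ne_zero_of_admissible (α : ℝ) (hα : ∀ n : ℕ, α ≠ -((n : ℝ) + 1))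
    (F1 F2 : Finset ℕ) (hF1 : ∀ f ∈ F1, 0 < f) (hF2 : ∀ f ∈ F2, 0 < f)
    (hne : F1.Nonempty ∨ F2.Nonempty)
    (hadm : IsAdmissible (α + 1) F1 F2) :
    -1 < α + ((F1.card + F2.card : ℕ) : ℝ) ∧
      ∀ x : ℝ, 0 ≤ x → (OmegaL α F1 F2).eval x ≠ 0 := by
  have hc : ∀ n : ℕ, α + 1 ≠ -(n : ℝ) := fun n h => hα n (by linarith)
  have hk : 0 < α + 1 + ((F1.card + F2.card : ℕ) : ℝ) := by
    have h1 := chat_pos hc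
    have h2 : (chat (α + 1) : ℝ) ≤ ((F1.card + F2.card : ℕ) : ℝ) := by
      exact_mod_cast chat_le hc hadm
    linarith
  refine ⟨by linarith, fun x hx h => ?_⟩
  obtain ⟨b, hb, H⟩ := rows_jets h
  apply hb
  funext f
  rcases hx.eq_or_lt with rfl | hx
  · have h1 := all_zero_zero (phiF_tower α F1 F2) (lamF_inj hα F1 F2) H f
    refine (mul_eq_zero.mp h1).resolve_right ?_
    unfold phiF
    split_ifs
    · exact towA_zero_ne hα _
    · exact towB_zero_ne hα _
  · have hG := core hk hx (phiF_tower α F1 F2) H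
      (fun n => by
        rw [Finset.prod_ne_zero_iff]
        intro j _ h0
        exact hc (n + j) (by push_cast; linarith))
      (fun n => by
        rw [lamF_prod]
        exact adm_ratio hc hadm n)
    have h1 := all_zero (phiF_tower α F1 F2) (lamF_inj hα F1 F2)
      (jets_all hx (phiF_tower α F1 F2) H hG) f
    have h2 : ∃ i, phiF α F1 F2 f i x ≠ 0 := by
      unfold phiF
      split_ifs
      · exact towA_exists_ne α _ x
      · exact towB_exists_ne α _ x
    obtain ⟨i, hi⟩ := h2
    exact (mul_eq_zero.mp (h1 i)).resolve_right hi
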